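/- arXiv:2212.11243 — 5 statements merged into one kernel-verified Lean document; each statement's English description precedes it below -/
import Mathlib

section
/- For every m ≥ 4, a (2,m) color ordering on a set S of m labels is uniquely determined by its restrictions to 4-element subsets: if σ and τ are (2,m) color orderings on S such that σ|_Q = τ|_Q for every 4-element subset Q ⊆ S, then σ = τ. -/
/-- Dihedral equivalence of lists: `l₂` is obtained from `l₁` by a rotation,
possibly composed with a reversal.  Two cyclic words represent the same
(2,m) color ordering iff they are dihedrally equivalent. -/
def DihEquiv {α : Type*} (l₁ l₂ : List α) : Prop :=
  List.IsRotated l₁ l₂ ∨ List.IsRotated l₁.reverse l₂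

/-- `l` is a representative of a (2, `S.card`) color ordering on the label set `S`. -/
def IsCyclicWord {α : Type*} [DecidableEq α] (S : Finset α) (l : List α) : Prop :=
  l.Nodup ∧ l.toFinset = S

/-- The restriction of a cyclic word to the labels lying in `S'`:
delete all other labels, keeping the induced cyclic order. -/
def restrictWord {α : Type*} [DecidableEq α] (l : List α) (S' : Finset α) : List α :=
  l.filter (fun x => x ∈ S')

namespace List

variable {α : Type*}

theorem IsRotated.exists_append {l l' : List α} (h : l ~r l') :
    ∃ s t, l = s ++ t ∧ l' = t ++ s := by
  obtain ⟨n, hn, rfl⟩ := isRotated_iff_mod.1 h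
  exact ⟨l.take n, l.drop n, by simp, rotate_eq_drop_append_take hn⟩

theorem IsRotated.filter {l l' : List α} (h : l ~r l') (p : α → Bool) :
    l.filter p ~r l'.filter p := by
  obtain ⟨s, t, rfl, rfl⟩ := h.exists_append
  simpa using isRotated_append

theorem exists_isRotated_cons_of_mem {a : α} {l : List α} (h : a ∈ l) :
    ∃ u, l ~r a :: u := by
  obtain ⟨s, t, rfl⟩ := append_of_mem h
  exact ⟨t ++ s, isRotated_append⟩

theorem IsRotated.tail_eq_of_nodup {a : α} {u v : List α} (h : (a :: u) ~r (a :: v))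
    (hu : (a :: u).Nodup) : u = v := by
  obtain ⟨s, t, hs, ht⟩ := h.exists_append
  rcases s with _ | ⟨b, s⟩
  · simp only [nil_append, append_nil] at hs ht
    exact (cons.inj (hs.trans ht.symm)).2
  · rcases t with _ | ⟨c, t⟩
    · simp_all
    · simp only [cons_append, cons.injEq] at hs ht
      obtain ⟨rfl, rfl⟩ := hs
      obtain ⟨rfl, rfl⟩ := ht
      simp at hu

theorem pair_sublist_or_of_mem {p q : α} (hpq : p ≠ q) {l : List α} (hp : p ∈ l) (hq : q ∈ l) :
    [p, q] <+ l ∨ [q, p] <+ l := by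
  induction l with
  | nil => simp at hp
  | cons a l ih =>
    rcases mem_cons.1 hp with rfl | hpl
    · exact .inl <| (singleton_sublist.2 <| (mem_cons.1 hq).resolve_left hpq.symm).cons_cons p
    · rcases mem_cons.1 hq with rfl | hql
      · exact .inr <| (singleton_sublist.2 hpl).cons_cons q
      · exact (ih hpl hql).imp (·.cons a) (·.cons a)

theorem Nodup.not_pair_sublist_swap {p q : α} {l : List α} (hl : l.Nodup) (h : [p, q] <+ l) :
    ¬ [q, p] <+ l := by
  intro h'
  induction l with
  | nil => simp at h
  | cons a l ih =>
    have ha := (nodup_cons.1 hl).1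
    rcases h with _ | h | h <;> rcases h' with _ | h' | h'
    · exact ih hl.of_cons ‹_› ‹_›
    all_goals
      grind

/-- If every triple of `u` occurs in `v` up to reversal, and the first two entries of `u`
appear in `v` in the same order, then `u = v`. -/
theorem Perm.eq_of_triples_of_pair_sublist {p q : α} {w v : List α} (hv : v.Nodup)
    (hperm : (p :: q :: w) ~ v)
    (h : ∀ x y z, [x, y, z] <+ p :: q :: w → [x, y, z] <+ v ∨ [z, y, x] <+ v)
    (hpq : [p, q] <+ v) : p :: q :: w = v := by
  have first : ∀ z ∈ q :: w, [p, z] <+ v := by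
    intro z hz
    rcases mem_cons.1 hz with rfl | hz
    · exact hpq
    · rcases h p q z (by simpa using hz) with h' | h'
      · exact (by simp : [p, z] <+ [p, q, z]).trans h'
      · exact absurd ((by simp : [q, p] <+ [z, q, p]).trans h') (hv.not_pair_sublist_swap hpq)
  refine hperm.eq_of_pairwise (le := fun x y => [x, y] <+ v)
    (fun x y _ _ hxy hyx => absurd hyx (hv.not_pair_sublist_swap hxy))
    (pairwise_cons.2 ⟨first, pairwise_of_forall_sublist fun {x y} hxy => ?_⟩)
    (pairwise_of_forall_sublist fun h => h)
  rcases h p x y (hxy.cons_cons p) with h' | h'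
  · exact (by simp : [x, y] <+ [p, x, y]).trans h'
  · exact absurd ((by simp : [x, p] <+ [y, x, p]).trans h')
      (hv.not_pair_sublist_swap (first x (hxy.subset (by simp))))

/-- A linear order on a finite set is determined up to reversal by its betweenness relation. -/
theorem Perm.eq_or_reverse_eq_of_triples {u v : List α} (hv : v.Nodup) (hperm : u ~ v)
    (h : ∀ x y z, [x, y, z] <+ u → [x, y, z] <+ v ∨ [z, y, x] <+ v) :
    u = v ∨ u.reverse = v := by
  match u with
  | [] => exact .inl hperm.nil_eq
  | [p] => exact .inl hperm.singleton_eq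
  | p :: q :: w =>
    have hne : p ≠ q := by
      have := hperm.nodup_iff.2 hv
      grind
    rcases pair_sublist_or_of_mem hne (hperm.subset (by simp)) (hperm.subset (by simp)) with
      hpq | hpq
    · exact .inl (hperm.eq_of_triples_of_pair_sublist hv h hpq)
    · refine .inr (reverse_eq_iff.2 ?_)
      refine Perm.eq_of_triples_of_pair_sublist (nodup_reverse.2 hv)
        (hperm.trans (reverse_perm v).symm) (fun x y z hxyz => ?_) (by simpa using hpq.reverse)
      exact (h x y z hxyz).symm.imp (fun k => by simpa using k.reverse)
        (fun k => by simpa using k.reverse)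

end List

section DihEquiv

variable {α : Type*}

theorem DihEquiv.congr {l₁ l₂ l₁' l₂' : List α} (h : DihEquiv l₁ l₂)
    (h₁ : l₁.IsRotated l₁') (h₂ : l₂.IsRotated l₂') : DihEquiv l₁' l₂' :=
  h.imp (fun k => (h₁.symm.trans k).trans h₂) (fun k => (h₁.reverse.symm.trans k).trans h₂)

theorem List.reverse_cons_isRotated (a : α) (u : List α) :
    (a :: u).reverse.IsRotated (a :: u.reverse) := by
  simpa using List.isRotated_concat a u.reverse

theorem dihEquiv_cons_iff {a : α} {u v : List α} (hu : (a :: u).Nodup) :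
    DihEquiv (a :: u) (a :: v) ↔ u = v ∨ u.reverse = v := by
  constructor
  · refine Or.imp (fun h => h.tail_eq_of_nodup hu) fun h => ?_
    exact ((List.reverse_cons_isRotated a u).symm.trans h).tail_eq_of_nodup (by simpa using hu)
  · rintro (rfl | rfl)
    · exact .inl (.refl _)
    · exact .inr (List.reverse_cons_isRotated a u)

theorem List.Sublist.restrictWord_toFinset [DecidableEq α] {t l : List α} (h : t.Sublist l)
    (hl : l.Nodup) : restrictWord l t.toFinset = t := by
  symm
  refine List.Sublist.eq_of_length_le (l₁ := t) ?_ ?_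
  · have := h.filter (fun x => decide (x ∈ t.toFinset))
    rwa [List.filter_eq_self.2 (by simp)] at this
  · have hn : (restrictWord l t.toFinset).Nodup := hl.filter _
    refine (hn.subperm ?_).length_le
    intro x hx
    simpa using (List.mem_filter.1 hx).2

end DihEquiv

/-- A (2,m) color ordering on a set `S` of `m ≥ 4` labels is uniquely determined by
its restrictions to the 4-element subsets of `S`. -/
theorem color_ordering_determined_by_quadruples {α : Type*} [DecidableEq α]
    (S : Finset α) (hm : 4 ≤ S.card) (l₁ l₂ : List α)
    (h₁ : IsCyclicWord S l₁) (h₂ : IsCyclicWord S l₂)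
    (h : ∀ Q : Finset α, Q ⊆ S → Q.card = 4 →
      DihEquiv (restrictWord l₁ Q) (restrictWord l₂ Q)) :
    DihEquiv l₁ l₂ := by
  obtain ⟨a, ha⟩ : S.Nonempty := Finset.card_pos.1 (by omega)
  obtain ⟨hn₁, hS₁⟩ := h₁
  obtain ⟨hn₂, hS₂⟩ := h₂
  obtain ⟨u, hu⟩ := List.exists_isRotated_cons_of_mem (List.mem_toFinset.1 (hS₁ ▸ ha))
  obtain ⟨v, hv⟩ := List.exists_isRotated_cons_of_mem (List.mem_toFinset.1 (hS₂ ▸ ha))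
  have hun : (a :: u).Nodup := hu.nodup_iff.1 hn₁
  have hvn : (a :: v).Nodup := hv.nodup_iff.1 hn₂
  have hperm : (a :: u).Perm (a :: v) :=
    hu.perm.symm.trans <|
      (List.perm_of_nodup_nodup_toFinset_eq hn₁ hn₂ (hS₁.trans hS₂.symm)).trans hv.perm
  refine DihEquiv.congr ((dihEquiv_cons_iff hun).2 ?_) hu.symm hv.symm
  refine hperm.cons_inv.eq_or_reverse_eq_of_triples hvn.of_cons fun x y z hxyz => ?_
  have hsub : [a, x, y, z].Sublist (a :: u) := hxyz.cons_cons a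
  have hnd : [a, x, y, z].Nodup := hun.sublist hsub
  have key := (h [a, x, y, z].toFinset
    (fun w hw => hS₁ ▸ List.mem_toFinset.2 (hu.mem_iff.2 (hsub.subset (List.mem_toFinset.1 hw))))
    (List.toFinset_card_of_nodup hnd)).congr (hu.filter _) (hv.filter _)
  change DihEquiv (restrictWord (a :: u) _) _ at key
  rw [hsub.restrictWord_toFinset hun, List.filter_cons_of_pos (by simp),
    dihEquiv_cons_iff hnd] at key
  have hle := List.filter_sublist (p := fun w => decide (w ∈ [a, x, y, z].toFinset)) (l := v)
  rcases key with k | k <;> rw [← k] at hle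
  · exact .inl hle
  · exact .inr (by simpa using hle)
end

section
/- Let n ≥ 3 and let T be a trivalent tree with leaf set L, |L| = n. Then the number of (2,n) color orderings on L that are compatible with T is exactly 2^{n−3}. -/
open scoped Classical

theorem dihEquiv_refl {α : Type*} (l : List α) : DihEquiv l l :=
  Or.inl (List.IsRotated.refl l)

theorem dihEquiv_symm {α : Type*} {l₁ l₂ : List α} (h : DihEquiv l₁ l₂) : DihEquiv l₂ l₁ := by
  rcases h with h | h
  · exact Or.inl h.symm
  · have h2 := h.reverse
    rw [List.reverse_reverse] at h2
    exact Or.inr h2.symm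

theorem dihEquiv_trans {α : Type*} {l₁ l₂ l₃ : List α} (h : DihEquiv l₁ l₂)
    (h' : DihEquiv l₂ l₃) : DihEquiv l₁ l₃ := by
  rcases h with h | h <;> rcases h' with h' | h'
  · exact Or.inl (h.trans h')
  · exact Or.inr (h.reverse.trans h')
  · exact Or.inr (h.trans h')
  · have h2 := h.reverse
    rw [List.reverse_reverse] at h2
    exact Or.inl (h2.trans h')

/-- The setoid whose quotient is the set of (2,m) color orderings represented by
cyclic words (lists up to rotation and reversal) satisfying `P`. -/
def wordSetoid {α : Type*} (P : List α → Prop) : Setoid {l : List α // P l} where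
  r l₁ l₂ := DihEquiv l₁.1 l₂.1
  iseqv := ⟨fun l => dihEquiv_refl l.1, dihEquiv_symm, dihEquiv_trans⟩

noncomputable section

/-- `G` is a trivalent tree whose set of leaves (degree-1 vertices) is exactly `L`,
all other vertices being internal of degree 3. -/
def IsTrivalentTree {V : Type*} [Fintype V] (G : SimpleGraph V) (L : Finset V) : Prop :=
  G.IsTree ∧ (∀ v : V, v ∈ L ↔ G.degree v = 1) ∧ ∀ v : V, v ∉ L → G.degree v = 3

/-- The block of the leaf partition induced by deleting the edge `{u,v}` of `G`:
the leaves in `L` lying on the `u`-side. -/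
def leafSide {V : Type*} [Fintype V] [DecidableEq V] (G : SimpleGraph V) (L : Finset V)
    (u v : V) : Finset V :=
  L.filter (fun x => (G.deleteEdges {s(u, v)}).Reachable u x)

/-- The labels in `B` occupy a contiguous arc of the cyclic word `l`. -/
def IsArc {α : Type*} [DecidableEq α] (l : List α) (B : Finset α) : Prop :=
  ∃ m k : ℕ, ((l.rotate m).take k).toFinset = B

/-- The cyclic word `l` is compatible with (planar with respect to) the tree `G` with
leaf set `L`: for every edge of `G`, each of the two blocks of the induced leaf
partition forms a contiguous arc of `l`. -/
def CompatTree {V : Type*} [Fintype V] [DecidableEq V] (G : SimpleGraph V) (L : Finset V)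
    (l : List V) : Prop :=
  ∀ u v : V, G.Adj u v → IsArc l (leafSide G L u v)

/-- The labels in `B` occupy a contiguous segment of the linear word `l`. -/
def IsSegment {α : Type*} [DecidableEq α] (l : List α) (B : Finset α) : Prop :=
  ∃ s : List α, s <:+: l ∧ s.toFinset = B

/-- `BinaryHierarchy A F`: the family `F` consists of the leaf sets of all subtrees of some rooted
binary tree with leaf set `A`. -/
inductive BinaryHierarchy {α : Type*} [DecidableEq α] : Finset α → Set (Finset α) → Prop
  | leaf (a : α) : BinaryHierarchy {a} {{a}}
  | node {A B : Finset α} {F F' : Set (Finset α)} : BinaryHierarchy A F → BinaryHierarchy B F' →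
      Disjoint A B → BinaryHierarchy (A ∪ B) (insert (A ∪ B) (F ∪ F'))

/-- The linear orderings of `A` in which every member of `F` is a segment. -/
def linearOrders {α : Type*} [DecidableEq α] (A : Finset α) (F : Set (Finset α)) : Set (List α) :=
  {l | l.Nodup ∧ l.toFinset = A ∧ ∀ C ∈ F, IsSegment l C}

section Lists

/-- A segment containing the first letter is an initial segment. -/
theorem exists_append_of_cons_infix {α : Type*} {x : α} {l s : List α} (hnd : (x :: l).Nodup)
    (hs : s <:+: x :: l) (hx : x ∈ s) : ∃ q, x :: l = s ++ q := by
  obtain ⟨p, q, h⟩ := hs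
  cases p with
  | nil => exact ⟨q, by simpa using h.symm⟩
  | cons y p =>
    simp only [List.cons_append, List.cons.injEq] at h
    obtain ⟨rfl, rfl⟩ := h
    simp [hx] at hnd

variable {α : Type*} [DecidableEq α]

theorem IsSegment.reverse {l : List α} {B : Finset α} (h : IsSegment l B) :
    IsSegment l.reverse B := by
  obtain ⟨s, hs, rfl⟩ := h
  exact ⟨s.reverse, List.reverse_infix.mpr hs, List.toFinset_reverse⟩

theorem reverse_mem_linearOrders {A : Finset α} {F : Set (Finset α)} {l : List α}
    (h : l ∈ linearOrders A F) : l.reverse ∈ linearOrders A F :=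
  ⟨List.nodup_reverse.mpr h.1, by rw [List.toFinset_reverse, h.2.1],
    fun C hC => (h.2.2 C hC).reverse⟩

theorem BinaryHierarchy.nonempty {A : Finset α} {F : Set (Finset α)} (h : BinaryHierarchy A F) :
    A.Nonempty := by
  induction h with
  | leaf a => simp
  | node _ _ _ ih _ => exact ih.inl

theorem BinaryHierarchy.mem_self {A : Finset α} {F : Set (Finset α)} (h : BinaryHierarchy A F) :
    A ∈ F := by
  cases h <;> simp

theorem BinaryHierarchy.subset_nonempty {A : Finset α} {F : Set (Finset α)}
    (h : BinaryHierarchy A F) : ∀ C ∈ F, C ⊆ A ∧ C.Nonempty := by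
  induction h with
  | leaf a => simp
  | @node A B F F' hA hB _ ihA ihB =>
    rintro C (rfl | hC | hC)
    · exact ⟨subset_rfl, hA.nonempty.inl⟩
    · exact ⟨(ihA C hC).1.trans Finset.subset_union_left, (ihA C hC).2⟩
    · exact ⟨(ihB C hC).1.trans Finset.subset_union_right, (ihB C hC).2⟩

theorem IsSegment.of_append_left {s q : List α} {C : Finset α} (hC : Disjoint C q.toFinset)
    (hne : C.Nonempty) (h : IsSegment (s ++ q) C) : IsSegment s C := by
  obtain ⟨t, ht, rfl⟩ := h
  rw [List.infix_append_iff] at ht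
  have key : ∀ x ∈ t, x ∉ q := by
    intro x hx hq
    exact Finset.disjoint_left.mp hC (List.mem_toFinset.mpr hx) (List.mem_toFinset.mpr hq)
  rcases ht with ht | ht | ⟨t₁, t₂, rfl, h₁, h₂⟩
  · exact ⟨t, ht, rfl⟩
  · obtain ⟨x, hx⟩ := hne
    rw [List.mem_toFinset] at hx
    exact absurd (ht.subset hx) (key x hx)
  · have : t₂ = [] := by
      rw [List.eq_nil_iff_forall_not_mem]
      intro x hx
      exact key x (by simp [hx]) (h₂.subset hx)
    subst this
    exact ⟨t₁, h₁.isInfix, by simp⟩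

theorem IsSegment.of_append_right {s q : List α} {C : Finset α} (hC : Disjoint C s.toFinset)
    (hne : C.Nonempty) (h : IsSegment (s ++ q) C) : IsSegment q C := by
  have h' := h.reverse
  rw [List.reverse_append] at h'
  simpa using (h'.of_append_left (by rwa [List.toFinset_reverse]) hne).reverse

theorem IsSegment.append_right {s : List α} {C : Finset α} (h : IsSegment s C) (q : List α) :
    IsSegment (s ++ q) C := by
  obtain ⟨t, ht, rfl⟩ := h
  exact ⟨t, List.infix_append_of_infix_left ht, rfl⟩

theorem IsSegment.append_left {q : List α} {C : Finset α} (h : IsSegment q C) (s : List α) :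
    IsSegment (s ++ q) C := by
  obtain ⟨t, ht, rfl⟩ := h
  exact ⟨t, List.infix_append_of_infix_right ht, rfl⟩

theorem isSegment_toFinset (l : List α) : IsSegment l l.toFinset :=
  ⟨l, List.infix_rfl, rfl⟩

/-- Two disjoint segments covering a word split it into a prefix and a suffix. -/
theorem eq_append_of_isSegment {A B : Finset α} (hA : A.Nonempty)
    (hd : Disjoint A B) {l : List α} (hnd : l.Nodup) (hl : l.toFinset = A ∪ B)
    (sA : IsSegment l A) (sB : IsSegment l B) :
    ∃ s q, s.toFinset = A ∧ q.toFinset = B ∧ (l = s ++ q ∨ l = q ++ s) := by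
  have main : ∀ {A B : Finset α}, Disjoint A B → l.toFinset = A ∪ B → IsSegment l A →
      (∃ x l', l = x :: l' ∧ x ∈ A) →
      ∃ s q, s.toFinset = A ∧ q.toFinset = B ∧ l = s ++ q := by
    rintro A B hd hl ⟨s, hs, rfl⟩ ⟨x, l', rfl, hx⟩
    obtain ⟨q, hq⟩ := exists_append_of_cons_infix hnd hs (by simpa using hx)
    refine ⟨s, q, rfl, ?_, hq⟩
    rw [hq] at hl hnd
    have hsq := List.disjoint_of_nodup_append hnd
    ext y
    have h1 := congrArg (y ∈ ·) hl
    have h2 : y ∈ s.toFinset → y ∉ B := fun h => Finset.disjoint_left.mp hd h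
    have h3 := @hsq y
    simp only [List.toFinset_append, Finset.mem_union, List.mem_toFinset, eq_iff_iff] at *
    tauto
  cases l with
  | nil =>
    obtain ⟨x, hx⟩ := hA
    have : x ∈ ([] : List α).toFinset := hl ▸ Finset.mem_union_left _ hx
    simp at this
  | cons x l' =>
    have hx : x ∈ A ∪ B := by rw [← hl]; simp
    rcases Finset.mem_union.mp hx with hx | hx
    · obtain ⟨s, q, h1, h2, h3⟩ := main hd hl sA ⟨x, l', rfl, hx⟩
      exact ⟨s, q, h1, h2, Or.inl h3⟩
    · obtain ⟨s, q, h1, h2, h3⟩ := main hd.symm (by rw [hl, Finset.union_comm]) sB ⟨x, l', rfl, hx⟩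
      exact ⟨q, s, h2, h1, Or.inr h3⟩

theorem append_mem_linearOrders {A B : Finset α} {F F' : Set (Finset α)} (hd : Disjoint A B)
    {s q : List α} (hs : s ∈ linearOrders A F) (hq : q ∈ linearOrders B F') :
    s ++ q ∈ linearOrders (A ∪ B) (insert (A ∪ B) (F ∪ F')) := by
  obtain ⟨hs1, hs2, hs3⟩ := hs
  obtain ⟨hq1, hq2, hq3⟩ := hq
  have htf : (s ++ q).toFinset = A ∪ B := by rw [List.toFinset_append, hs2, hq2]
  refine ⟨List.nodup_append'.mpr ⟨hs1, hq1, ?_⟩, htf, ?_⟩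
  · intro x hx hx'
    subst hs2 hq2
    exact Finset.disjoint_left.mp hd (List.mem_toFinset.mpr hx) (List.mem_toFinset.mpr hx')
  · rintro C (rfl | hC | hC)
    · exact htf ▸ isSegment_toFinset _
    · exact (hs3 C hC).append_right q
    · exact (hq3 C hC).append_left s

theorem linearOrders_node {A B : Finset α} {F F' : Set (Finset α)} (hA : BinaryHierarchy A F)
    (hB : BinaryHierarchy B F') (hd : Disjoint A B) :
    linearOrders (A ∪ B) (insert (A ∪ B) (F ∪ F')) =
      (fun p : List α × List α => p.1 ++ p.2) '' (linearOrders A F ×ˢ linearOrders B F') ∪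
      (fun p : List α × List α => p.1 ++ p.2) '' (linearOrders B F' ×ˢ linearOrders A F) := by
  ext l
  constructor
  · rintro ⟨hnd, hl, hF⟩
    obtain ⟨s, q, rfl, rfl, h⟩ := eq_append_of_isSegment hA.nonempty hd hnd hl
      (hF _ (by simp [hA.mem_self])) (hF _ (by simp [hB.mem_self]))
    have hC : ∀ C ∈ F, Disjoint C q.toFinset ∧ C.Nonempty := fun C h =>
      ⟨hd.mono_left (hA.subset_nonempty C h).1, (hA.subset_nonempty C h).2⟩
    have hC' : ∀ C ∈ F', Disjoint C s.toFinset ∧ C.Nonempty := fun C h =>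
      ⟨hd.symm.mono_left (hB.subset_nonempty C h).1, (hB.subset_nonempty C h).2⟩
    have hsegF : ∀ C ∈ F, IsSegment l C := fun C h => hF C (by simp [h])
    have hsegF' : ∀ C ∈ F', IsSegment l C := fun C h => hF C (by simp [h])
    rcases h with rfl | rfl
    · refine Or.inl ⟨(s, q), ⟨⟨hnd.of_append_left, rfl, fun C h => ?_⟩,
        ⟨hnd.of_append_right, rfl, fun C h => ?_⟩⟩, rfl⟩
      · exact (hsegF C h).of_append_left (hC C h).1 (hC C h).2
      · exact (hsegF' C h).of_append_right (hC' C h).1 (hC' C h).2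
    · refine Or.inr ⟨(q, s), ⟨⟨hnd.of_append_left, rfl, fun C h => ?_⟩,
        ⟨hnd.of_append_right, rfl, fun C h => ?_⟩⟩, rfl⟩
      · exact (hsegF' C h).of_append_left (hC' C h).1 (hC' C h).2
      · exact (hsegF C h).of_append_right (hC C h).1 (hC C h).2
  · rintro (⟨⟨s, q⟩, ⟨hs, hq⟩, rfl⟩ | ⟨⟨s, q⟩, ⟨hs, hq⟩, rfl⟩)
    · exact append_mem_linearOrders hd hs hq
    · rw [Finset.union_comm, Set.union_comm]
      exact append_mem_linearOrders hd.symm hs hq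

theorem length_of_mem_linearOrders {A : Finset α} {F : Set (Finset α)} {l : List α}
    (h : l ∈ linearOrders A F) : l.length = A.card := by
  rw [← h.2.1, List.toFinset_card_of_nodup h.1]

theorem ncard_image_append (A B : Finset α) (F F' : Set (Finset α)) :
    ((fun p : List α × List α => p.1 ++ p.2) ''
      (linearOrders A F ×ˢ linearOrders B F')).ncard =
      (linearOrders A F).ncard * (linearOrders B F').ncard := by
  rw [Set.InjOn.ncard_image, Set.ncard_prod]
  rintro ⟨s, q⟩ ⟨hs, -⟩ ⟨s', q'⟩ ⟨hs', -⟩ h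
  have := List.append_inj h ((length_of_mem_linearOrders hs).trans
    (length_of_mem_linearOrders hs').symm)
  exact Prod.ext this.1 this.2

theorem BinaryHierarchy.ncard_linearOrders {A : Finset α} {F : Set (Finset α)}
    (h : BinaryHierarchy A F) : (linearOrders A F).ncard = 2 ^ (A.card - 1) := by
  induction h with
  | leaf a =>
    have : linearOrders ({a} : Finset α) {{a}} = {[a]} := by
      ext l
      constructor
      · intro h
        have hlen := length_of_mem_linearOrders h
        rw [Finset.card_singleton, List.length_eq_one_iff] at hlen
        obtain ⟨b, rfl⟩ := hlen
        simpa using h.2.1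
      · rintro rfl
        exact ⟨by simp, by simp, by rintro C rfl; exact isSegment_toFinset [a]⟩
    simp [this]
  | @node A B F F' hA hB hd ihA ihB =>
    have hdisj : Disjoint
        ((fun p : List α × List α => p.1 ++ p.2) '' (linearOrders A F ×ˢ linearOrders B F'))
        ((fun p : List α × List α => p.1 ++ p.2) '' (linearOrders B F' ×ˢ linearOrders A F)) := by
      rw [Set.disjoint_left]
      rintro _ ⟨⟨s, q⟩, ⟨hs, hq⟩, rfl⟩ ⟨⟨q', s'⟩, ⟨hq', hs'⟩, h⟩
      dsimp only at hs hq hs' hq' h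
      cases s with
      | nil =>
        have := hs.2.1
        exact hA.nonempty.ne_empty (by simpa using this.symm)
      | cons x s =>
        cases q' with
        | nil =>
          have := hq'.2.1
          exact hB.nonempty.ne_empty (by simpa using this.symm)
        | cons y q' =>
          simp only [List.cons_append, List.cons.injEq] at h
          obtain ⟨rfl, -⟩ := h
          refine Finset.disjoint_left.mp hd (show y ∈ A from ?_) ?_
          · rw [← hs.2.1]; simp
          · rw [← hq'.2.1]; simp
    have hA' : (linearOrders A F).Finite := Set.finite_of_ncard_ne_zero (by simp [ihA])
    have hB' : (linearOrders B F').Finite := Set.finite_of_ncard_ne_zero (by simp [ihB])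
    rw [linearOrders_node hA hB hd, Set.ncard_union_eq hdisj ((hA'.prod hB').image _)
      ((hB'.prod hA').image _),
      ncard_image_append, ncard_image_append, ihA, ihB, Finset.card_union_of_disjoint hd]
    have h1 := hA.nonempty.card_pos
    have h2 := hB.nonempty.card_pos
    obtain ⟨a, ha⟩ := Nat.exists_eq_add_of_le' h1
    obtain ⟨b, hb⟩ := Nat.exists_eq_add_of_le' h2
    rw [ha, hb, show a + 1 + (b + 1) - 1 = a + b + 1 by omega]
    simp only [Nat.add_sub_cancel]
    ring

end Lists

section CyclicWords

theorem card_eq_two_mul_of_involutive_fibers {X Q : Type*} [Finite X] {f : X → Q}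
    (hf : Function.Surjective f) (g : X → X) (hg : ∀ x, g x ≠ x)
    (hfg : ∀ x y, f x = f y ↔ y = x ∨ y = g x) : Nat.card X = 2 * Nat.card Q := by
  have : Finite Q := Finite.of_surjective f hf
  have := Fintype.ofFinite X
  have := Fintype.ofFinite Q
  rw [Nat.card_eq_fintype_card, Nat.card_eq_fintype_card, ← Finset.card_univ,
    Finset.card_eq_sum_card_fiberwise (f := f) (t := Finset.univ) (by simp)]
  rw [Finset.sum_const_nat (m := 2), Finset.card_univ, mul_comm]
  intro q _
  obtain ⟨x, rfl⟩ := hf q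
  rw [show Finset.univ.filter (fun y => f y = f x) = {x, g x} by
    ext y; rw [Finset.mem_filter_univ, eq_comm, hfg, Finset.mem_insert, Finset.mem_singleton]]
  exact Finset.card_pair (hg x).symm

theorem eq_of_cons_isRotated_cons {α : Type*} {r : α} {l l' : List α} (hnd : (r :: l).Nodup)
    (h : (r :: l) ~r (r :: l')) : l = l' := by
  obtain ⟨n, hn, h⟩ := List.isRotated_iff_mod.mp h
  rw [List.rotate_eq_drop_append_take hn] at h
  have hsplit := List.take_append_drop n (r :: l)
  generalize List.take n (r :: l) = a at *
  generalize List.drop n (r :: l) = b at *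
  cases a with
  | nil => simp_all
  | cons x a =>
    cases b with
    | nil => simp_all
    | cons y b =>
      simp only [List.cons_append, List.cons.injEq] at h hsplit
      rw [← hsplit.2, h.1] at hnd
      simp at hnd

theorem dihEquiv_cons_iff_s2 {α : Type*} {r : α} {l l' : List α} (hnd : (r :: l).Nodup) :
    DihEquiv (r :: l) (r :: l') ↔ l' = l ∨ l' = l.reverse := by
  have hrev : (r :: l).reverse ~r (r :: l.reverse) := by
    rw [List.reverse_cons]
    exact List.isRotated_concat r l.reverse
  have hnd' : (r :: l.reverse).Nodup := by simpa using hnd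
  constructor
  · rintro (h | h)
    · exact Or.inl (eq_of_cons_isRotated_cons hnd h).symm
    · exact Or.inr (eq_of_cons_isRotated_cons hnd' (hrev.symm.trans h)).symm
  · rintro (rfl | rfl)
    · exact dihEquiv_refl _
    · exact Or.inr hrev

theorem reverse_ne_self {α : Type*} {l : List α} (hnd : l.Nodup) (hl : 2 ≤ l.length) : l.reverse ≠ l := by
  intro h
  have h0 : l.reverse[0]'(by simp; omega) = l[0] := by simp only [h]
  rw [List.getElem_reverse, hnd.getElem_inj_iff] at h0
  omega

variable {α : Type*} [DecidableEq α]

theorem isArc_iff {l : List α} {B : Finset α} :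
    IsArc l B ↔ ∃ t d, l ~r (t ++ d) ∧ t.toFinset = B := by
  constructor
  · rintro ⟨m, k, rfl⟩
    exact ⟨_, (l.rotate m).drop k, ⟨m, by rw [List.take_append_drop]⟩, rfl⟩
  · rintro ⟨t, d, ⟨m, hm⟩, rfl⟩
    exact ⟨m, t.length, by rw [hm, List.take_left]⟩

theorem IsArc.of_isRotated {l l' : List α} {B : Finset α} (h : IsArc l B) (hl : l ~r l') :
    IsArc l' B := by
  obtain ⟨t, d, h, ht⟩ := isArc_iff.mp h
  exact isArc_iff.mpr ⟨t, d, hl.symm.trans h, ht⟩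

theorem IsArc.compl {l : List α} {B C : Finset α} (hnd : l.Nodup) (h : IsArc l B)
    (hd : Disjoint B C) (hBC : B ∪ C = l.toFinset) : IsArc l C := by
  obtain ⟨t, d, hrot, rfl⟩ := isArc_iff.mp h
  refine isArc_iff.mpr ⟨d, t, hrot.trans List.isRotated_append, ?_⟩
  have hdisj := List.disjoint_of_nodup_append (hrot.nodup_iff.mp hnd)
  ext y
  have h1 : y ∈ t.toFinset ∪ C ↔ y ∈ l.toFinset := by rw [hBC]
  have h2 : y ∈ t.toFinset → y ∉ C := fun h => Finset.disjoint_left.mp hd h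
  have h3 : y ∈ t → y ∉ d := fun h h' => hdisj h h'
  have h4 := hrot.mem_iff (a := y)
  simp only [List.mem_append, Finset.mem_union, List.mem_toFinset] at *
  tauto

theorem isArc_cons_iff {r : α} {l : List α} {C : Finset α} (hnd : (r :: l).Nodup) (hr : r ∉ C) :
    IsArc (r :: l) C ↔ IsSegment l C := by
  rw [isArc_iff]
  constructor
  · rintro ⟨t, d, h, rfl⟩
    have hrd : r ∈ d := by
      have := h.mem_iff.mp (List.mem_cons_self (a := r) (l := l))
      rw [List.mem_append] at this
      exact this.resolve_left (by simpa using hr)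
    obtain ⟨d₁, d₂, rfl⟩ := List.append_of_mem hrd
    have h' : (r :: l) ~r (r :: (d₂ ++ t ++ d₁)) := by
      refine h.trans ?_
      have := List.isRotated_append (l := t ++ d₁) (l' := r :: d₂)
      simpa using this
    rw [eq_of_cons_isRotated_cons hnd h']
    exact ⟨t, ⟨d₂, d₁, rfl⟩, rfl⟩
  · rintro ⟨t, ⟨p, q, rfl⟩, rfl⟩
    refine ⟨t, q ++ r :: p, ?_, rfl⟩
    have := List.isRotated_append (l := r :: p) (l' := t ++ q)
    simpa using this

end CyclicWords

section Trees

variable {V : Type*} {G : SimpleGraph V}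

/-- The vertices on the `u`-side of the edge `{u, v}`. -/
def edgeSide (G : SimpleGraph V) (u v : V) : Set V :=
  {x | (G.deleteEdges {s(u, v)}).Reachable u x}

/-- `edgeSide G u v` is closed under crossing edges other than `{u, v}`. -/
theorem mem_edgeSide_of_adj {u v x y : V} (hx : x ∈ edgeSide G u v) (h : G.Adj x y)
    (hne : s(x, y) ≠ s(u, v)) : y ∈ edgeSide G u v :=
  SimpleGraph.Reachable.trans hx
    (SimpleGraph.Adj.reachable (by simpa [SimpleGraph.deleteEdges_adj, h] using hne))

theorem left_mem_edgeSide (u v : V) : u ∈ edgeSide G u v := SimpleGraph.Reachable.refl u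

theorem edgeSide_subset {u v : V} {S : Set V} (hu : u ∈ S)
    (hS : ∀ x y, x ∈ S → x ∈ edgeSide G u v → G.Adj x y → s(x, y) ≠ s(u, v) → y ∈ S) :
    edgeSide G u v ⊆ S := by
  intro x hx
  have hx' := (SimpleGraph.reachable_iff_reflTransGen u x).mp hx
  induction hx' with
  | refl => exact hu
  | @tail y z hy hyz ih =>
    have hy' := (SimpleGraph.reachable_iff_reflTransGen u y).mpr hy
    rw [SimpleGraph.deleteEdges_adj] at hyz
    exact hS y z (ih hy') hy' hyz.1 (by simpa using hyz.2)

theorem right_notMem_edgeSide (hG : G.IsAcyclic) {u v : V} (h : G.Adj u v) :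
    v ∉ edgeSide G u v :=
  SimpleGraph.isBridge_iff.mp (SimpleGraph.isAcyclic_iff_forall_adj_isBridge.mp hG h)

theorem edgeSide_disjoint (hG : G.IsAcyclic) {u v : V} (h : G.Adj u v) :
    Disjoint (edgeSide G u v) (edgeSide G v u) := by
  rw [Set.disjoint_left]
  intro x hx hx'
  refine right_notMem_edgeSide hG h ?_
  rw [edgeSide, Set.mem_ofPred_eq, Sym2.eq_swap] at hx'
  exact SimpleGraph.Reachable.trans hx hx'.symm

theorem edgeSide_union (hG : G.Connected) (u v : V) :
    edgeSide G u v ∪ edgeSide G v u = Set.univ := by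
  rw [Set.eq_univ_iff_forall]
  intro x
  have hx := (SimpleGraph.reachable_iff_reflTransGen u x).mp (hG.preconnected u x)
  induction hx with
  | refl => exact Or.inl (left_mem_edgeSide u v)
  | @tail y z _ hyz ih =>
    by_cases he : s(y, z) = s(u, v)
    · rcases Sym2.eq_iff.mp he with ⟨-, rfl⟩ | ⟨-, rfl⟩
      · exact Or.inr (left_mem_edgeSide _ _)
      · exact Or.inl (left_mem_edgeSide _ _)
    · exact ih.imp (fun h => mem_edgeSide_of_adj h hyz he)
        (fun h => mem_edgeSide_of_adj h hyz (by rwa [Sym2.eq_swap (a := v)]))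

theorem edgeSide_subset_edgeSide (hG : G.IsAcyclic) {u v a : V} (huv : G.Adj v u)
    (hav : G.Adj v a) (hau : a ≠ u) : edgeSide G a v ⊆ edgeSide G v u := by
  apply edgeSide_subset
  · refine mem_edgeSide_of_adj (left_mem_edgeSide v u) hav ?_
    simp [hau, hav.ne']
  · intro x y hx hx' hxy _
    refine mem_edgeSide_of_adj hx hxy fun he => ?_
    rcases Sym2.eq_iff.mp he with ⟨rfl, -⟩ | ⟨rfl, -⟩
    · exact right_notMem_edgeSide hG hav.symm hx'
    · exact right_notMem_edgeSide hG huv hx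

theorem mem_edgeSide_iff (hG : G.IsAcyclic) {u v x : V} (huv : G.Adj v u) :
    x ∈ edgeSide G v u ↔ x = v ∨ ∃ a, G.Adj v a ∧ a ≠ u ∧ x ∈ edgeSide G a v := by
  constructor
  · intro hx
    have : edgeSide G v u ⊆ {x | x = v ∨ ∃ a, G.Adj v a ∧ a ≠ u ∧ x ∈ edgeSide G a v} := by
      apply edgeSide_subset
      · exact Or.inl rfl
      · rintro x y (rfl | ⟨a, hva, hau, hx⟩) _ hxy he
        · exact Or.inr ⟨y, hxy, by rintro rfl; exact he rfl, left_mem_edgeSide _ _⟩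
        · by_cases he' : s(x, y) = s(a, v)
          · rcases Sym2.eq_iff.mp he' with ⟨-, rfl⟩ | ⟨rfl, -⟩
            · exact Or.inl rfl
            · exact absurd hx (right_notMem_edgeSide hG hva.symm)
          · exact Or.inr ⟨a, hva, hau, mem_edgeSide_of_adj hx hxy he'⟩
    exact this hx
  · rintro (rfl | ⟨a, hva, hau, hx⟩)
    · exact left_mem_edgeSide _ _
    · exact edgeSide_subset_edgeSide hG huv hva hau hx

/-- `(x, y)` is followed by `(y, z)` along a non-backtracking walk. -/
def NextDart (G : SimpleGraph V) (d e : V × V) : Prop :=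
  d.2 = e.1 ∧ G.Adj e.1 e.2 ∧ e.2 ≠ d.1

/-- The darts `(x, y)` reached by non-backtracking walks starting with the dart `(u, v)`. -/
def DartReach (G : SimpleGraph V) : V × V → V × V → Prop :=
  Relation.ReflTransGen (NextDart G)

theorem DartReach.adj {u v x y : V} (huv : G.Adj u v) (h : DartReach G (u, v) (x, y)) :
    G.Adj x y := by
  rcases Relation.ReflTransGen.cases_tail h with h | ⟨_, -, -, h, -⟩
  · obtain ⟨rfl, rfl⟩ := Prod.mk.inj h
    exact huv
  · exact h

/-- From a leaf, each edge is reached in one of its two directions. -/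
theorem dartReach_or_swap (hG : G.Connected) {r v x y : V} (hrv : G.Adj r v)
    (hr : ∀ w, G.Adj r w → w = v) (hxy : G.Adj x y) :
    DartReach G (r, v) (x, y) ∨ DartReach G (r, v) (y, x) := by
  have key : ∀ a b, DartReach G (r, v) (a, b) → ∀ z, G.Adj b z →
      DartReach G (r, v) (b, z) ∨ DartReach G (r, v) (z, b) := by
    intro a b hab z hbz
    by_cases hza : z = a
    · subst hza
      exact Or.inr hab
    · exact Or.inl (hab.tail ⟨rfl, hbz, hza⟩)
  have hx := (SimpleGraph.reachable_iff_reflTransGen r x).mp (hG.preconnected r x)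
  induction hx generalizing y with
  | refl =>
    obtain rfl := hr y hxy
    exact Or.inl Relation.ReflTransGen.refl
  | @tail w x _ hwx ih =>
    rcases ih hwx with h | h
    · exact key w x h y hxy
    · rcases Relation.ReflTransGen.cases_tail h with h' | ⟨⟨a, b⟩, h', hb, -⟩
      · obtain ⟨rfl, rfl⟩ := Prod.mk.inj h'
        obtain rfl := hr y hxy
        exact Or.inl Relation.ReflTransGen.refl
      · dsimp only at hb
        subst hb
        exact key a b h' y hxy

variable [Fintype V] {L : Finset V}

theorem IsTrivalentTree.eq_of_adj_leaf (hG : IsTrivalentTree G L) {v u w : V} (hv : v ∈ L)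
    (hu : G.Adj v u) (hw : G.Adj v w) : w = u := by
  have h := (hG.2.1 v).mp hv
  rw [← SimpleGraph.card_neighborFinset_eq_degree, Finset.card_eq_one] at h
  obtain ⟨a, ha⟩ := h
  have hu' : u ∈ G.neighborFinset v := by simpa using hu
  have hw' : w ∈ G.neighborFinset v := by simpa using hw
  rw [ha, Finset.mem_singleton] at hu' hw'
  rw [hu', hw']

theorem IsTrivalentTree.exists_adj_leaf (hG : IsTrivalentTree G L) {v : V} (hv : v ∈ L) :
    ∃ u, G.Adj v u := by
  have h := (hG.2.1 v).mp hv
  exact (SimpleGraph.degree_pos_iff_exists_adj (G := G) v).mp (by omega)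

variable [DecidableEq V]

theorem mem_leafSide {u v x : V} : x ∈ leafSide G L u v ↔ x ∈ L ∧ x ∈ edgeSide G u v := by
  simp [leafSide, edgeSide]

theorem IsTrivalentTree.exists_adj_internal (hG : IsTrivalentTree G L) {v u : V} (hv : v ∉ L)
    (hu : G.Adj v u) : ∃ a b, a ≠ b ∧ a ≠ u ∧ b ≠ u ∧ G.Adj v a ∧ G.Adj v b ∧
      ∀ w, G.Adj v w → w ≠ u → w = a ∨ w = b := by
  have h := hG.2.2 v hv
  have hu' : u ∈ G.neighborFinset v := by simpa using hu
  rw [← SimpleGraph.card_neighborFinset_eq_degree] at h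
  have h2 : ((G.neighborFinset v).erase u).card = 2 := by
    rw [Finset.card_erase_of_mem hu', h]
  obtain ⟨a, b, hab, he⟩ := Finset.card_eq_two.mp h2
  have hmem : ∀ w, (w ≠ u ∧ G.Adj v w) ↔ (w = a ∨ w = b) := by
    intro w
    have : w ∈ (G.neighborFinset v).erase u ↔ w ∈ ({a, b} : Finset V) := by rw [he]
    simpa using this
  have ha := (hmem a).mpr (Or.inl rfl)
  have hb := (hmem b).mpr (Or.inr rfl)
  exact ⟨a, b, hab, ha.1, hb.1, ha.2, hb.2, fun w h1 h2 => (hmem w).mp ⟨h2, h1⟩⟩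

theorem leafSide_disjoint (hG : G.IsAcyclic) {u v : V} (h : G.Adj u v) :
    Disjoint (leafSide G L u v) (leafSide G L v u) := by
  rw [Finset.disjoint_left]
  intro x hx hx'
  exact Set.disjoint_left.mp (edgeSide_disjoint hG h) (mem_leafSide.mp hx).2 (mem_leafSide.mp hx').2

theorem leafSide_union (hG : G.Connected) (u v : V) :
    leafSide G L u v ∪ leafSide G L v u = L := by
  ext x
  have : x ∈ edgeSide G u v ∪ edgeSide G v u := by rw [edgeSide_union hG]; trivial
  rw [Set.mem_union] at this
  simp only [Finset.mem_union, mem_leafSide]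
  tauto

theorem IsTrivalentTree.leafSide_leaf (hG : IsTrivalentTree G L) {u v : V} (hv : v ∈ L)
    (huv : G.Adj v u) : leafSide G L v u = {v} := by
  ext x
  rw [mem_leafSide, mem_edgeSide_iff hG.1.isAcyclic huv, Finset.mem_singleton]
  constructor
  · rintro ⟨-, rfl | ⟨a, ha, hau, -⟩⟩
    · rfl
    · exact absurd (hG.eq_of_adj_leaf hv huv ha) hau
  · rintro rfl
    exact ⟨hv, Or.inl rfl⟩

/-- The leaf sets beyond the darts reached from `(u, v)`. -/
def reachedLeafSides (G : SimpleGraph V) (L : Finset V) (u v : V) : Set (Finset V) :=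
  {C | ∃ x y, DartReach G (u, v) (x, y) ∧ leafSide G L y x = C}

theorem IsTrivalentTree.binaryHierarchy (hG : IsTrivalentTree G L) {u v : V} (huv : G.Adj v u) :
    BinaryHierarchy (leafSide G L v u) (reachedLeafSides G L u v) := by
  induction hn : (edgeSide G v u).ncard using Nat.strong_induction_on generalizing u v with
  | _ n ih =>
  by_cases hv : v ∈ L
  · have hF : reachedLeafSides G L u v = {leafSide G L v u} := by
      ext C
      constructor
      · rintro ⟨x, y, h, rfl⟩
        rcases Relation.ReflTransGen.cases_head h with h | ⟨⟨a, b⟩, ⟨h1, h2, h3⟩, -⟩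
        · obtain ⟨rfl, rfl⟩ := Prod.mk.inj h
          rfl
        · dsimp only at h1 h2 h3
          subst h1
          exact absurd (hG.eq_of_adj_leaf hv huv h2) h3
      · rintro rfl
        exact ⟨u, v, Relation.ReflTransGen.refl, rfl⟩
    rw [hF, hG.leafSide_leaf hv huv]
    exact BinaryHierarchy.leaf v
  · obtain ⟨a, b, hab, hau, hbu, hva, hvb, hw⟩ := hG.exists_adj_internal hv huv
    have hac := hG.1.isAcyclic
    have hlt : ∀ c, G.Adj v c → c ≠ u → (edgeSide G c v).ncard < n := by
      intro c hc hcu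
      rw [← hn]
      refine Set.ncard_lt_ncard ((Set.ssubset_iff_of_subset
        (edgeSide_subset_edgeSide hac huv hc hcu)).mpr ⟨v, left_mem_edgeSide v u,
          right_notMem_edgeSide hac hc.symm⟩) (Set.toFinite _)
    have hunion : leafSide G L v u = leafSide G L a v ∪ leafSide G L b v := by
      ext x
      rw [Finset.mem_union, mem_leafSide, mem_leafSide, mem_leafSide, mem_edgeSide_iff hac huv]
      constructor
      · rintro ⟨hx, rfl | ⟨c, hc, hcu, hxc⟩⟩
        · exact absurd hx hv
        · rcases hw c hc hcu with rfl | rfl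
          · exact Or.inl ⟨hx, hxc⟩
          · exact Or.inr ⟨hx, hxc⟩
      · rintro (⟨hx, h⟩ | ⟨hx, h⟩)
        · exact ⟨hx, Or.inr ⟨a, hva, hau, h⟩⟩
        · exact ⟨hx, Or.inr ⟨b, hvb, hbu, h⟩⟩
    have hdisj : Disjoint (leafSide G L a v) (leafSide G L b v) := by
      rw [Finset.disjoint_left]
      intro x hx hx'
      exact Set.disjoint_left.mp (edgeSide_disjoint hac hvb)
        (edgeSide_subset_edgeSide hac hvb hva hab (mem_leafSide.mp hx).2) (mem_leafSide.mp hx').2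
    have hF : reachedLeafSides G L u v = insert (leafSide G L v u)
        (reachedLeafSides G L v a ∪ reachedLeafSides G L v b) := by
      ext C
      constructor
      · rintro ⟨x, y, h, rfl⟩
        rcases Relation.ReflTransGen.cases_head h with h | ⟨⟨c, d⟩, ⟨h1, h2, h3⟩, h⟩
        · obtain ⟨rfl, rfl⟩ := Prod.mk.inj h
          exact Or.inl rfl
        · dsimp only at h1 h2 h3
          subst h1
          rcases hw d h2 h3 with rfl | rfl
          · exact Or.inr (Or.inl ⟨x, y, h, rfl⟩)
          · exact Or.inr (Or.inr ⟨x, y, h, rfl⟩)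
      · rintro (rfl | ⟨x, y, h, rfl⟩ | ⟨x, y, h, rfl⟩)
        · exact ⟨u, v, Relation.ReflTransGen.refl, rfl⟩
        · exact ⟨x, y, h.head ⟨rfl, hva, hau⟩, rfl⟩
        · exact ⟨x, y, h.head ⟨rfl, hvb, hbu⟩, rfl⟩
    rw [hF, hunion]
    exact BinaryHierarchy.node (ih _ (hlt a hva hau) hva.symm rfl)
      (ih _ (hlt b hvb hbu) hvb.symm rfl) hdisj

theorem IsTrivalentTree.leafSide_eq_erase (hG : IsTrivalentTree G L) {r v : V} (hr : r ∈ L)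
    (hrv : G.Adj r v) : leafSide G L v r = L.erase r := by
  have hu := leafSide_union (L := L) hG.1.connected r v
  have hd := leafSide_disjoint (L := L) hG.1.isAcyclic hrv
  rw [hG.leafSide_leaf hr hrv] at hu hd
  rw [Finset.disjoint_singleton_left] at hd
  rw [← Finset.insert_eq] at hu
  exact (Finset.erase_insert hd).symm.trans (congrArg (Finset.erase · r) hu)

/-- Cutting a cyclic word at the leaf `r` turns compatible words into linear orders. -/
theorem IsTrivalentTree.cons_compat_iff (hG : IsTrivalentTree G L) {r v : V} (hr : r ∈ L)
    (hrv : G.Adj r v) (l : List V) :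
    ((r :: l).Nodup ∧ (r :: l).toFinset = L ∧ CompatTree G L (r :: l)) ↔
      l ∈ linearOrders (leafSide G L v r) (reachedLeafSides G L r v) := by
  have hH := hG.binaryHierarchy hrv.symm
  have hset := hG.leafSide_eq_erase hr hrv
  have hrC : ∀ C ∈ reachedLeafSides G L r v, r ∉ C := by
    intro C hC hrC
    have := (hH.subset_nonempty C hC).1 hrC
    simp [hset] at this
  constructor
  · rintro ⟨hnd, hL, hc⟩
    refine ⟨hnd.of_cons, ?_, fun C hC => ?_⟩
    · rw [hset, ← hL, List.toFinset_cons, Finset.erase_insert]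
      simpa using (List.nodup_cons.mp hnd).1
    · rw [← isArc_cons_iff hnd (hrC C hC)]
      obtain ⟨x, y, h, rfl⟩ := hC
      exact hc y x (h.adj hrv).symm
  · rintro ⟨hnd, hl, hF⟩
    have hnd' : (r :: l).Nodup := by
      refine List.nodup_cons.mpr ⟨?_, hnd⟩
      rw [← List.mem_toFinset, hl, hset]
      simp
    have hL : (r :: l).toFinset = L := by
      rw [List.toFinset_cons, hl, hset, Finset.insert_erase hr]
    have harc : ∀ x y, DartReach G (r, v) (x, y) → IsArc (r :: l) (leafSide G L y x) := by
      intro x y h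
      have hC : leafSide G L y x ∈ reachedLeafSides G L r v := ⟨x, y, h, rfl⟩
      exact (isArc_cons_iff hnd' (hrC _ hC)).mpr (hF _ hC)
    refine ⟨hnd', hL, fun x y hxy => ?_⟩
    rcases dartReach_or_swap hG.1.connected hrv (fun w => hG.eq_of_adj_leaf hr hrv) hxy with h | h
    · refine (harc x y h).compl hnd' (leafSide_disjoint hG.1.isAcyclic hxy.symm) ?_
      rw [hL, leafSide_union hG.1.connected]
    · exact harc y x h

end Trees

/-- If `G` is a trivalent tree with leaf set `L` of cardinality `n ≥ 3`, then the number
of (2,n) color orderings on `L` that are compatible with `G` equals `2 ^ (n - 3)`. -/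
theorem card_compatible_color_orderings {V : Type*} [Fintype V] [DecidableEq V]
    (G : SimpleGraph V) (L : Finset V) (hn : 3 ≤ L.card) (hG : IsTrivalentTree G L) :
    Nat.card (Quotient (wordSetoid
        (fun l : List V => l.Nodup ∧ l.toFinset = L ∧ CompatTree G L l))) =
      2 ^ (L.card - 3) := by
  obtain ⟨r, hr⟩ : L.Nonempty := Finset.card_pos.mp (by omega)
  obtain ⟨v, hrv⟩ := hG.exists_adj_leaf hr
  have hcons := hG.cons_compat_iff hr hrv
  have hcardA : (leafSide G L v r).card = L.card - 1 := by
    rw [hG.leafSide_eq_erase hr hrv, Finset.card_erase_of_mem hr]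
  have hcard := (hG.binaryHierarchy hrv.symm).ncard_linearOrders
  set O := linearOrders (leafSide G L v r) (reachedLeafSides G L r v) with hO
  have hfin : Finite O := Set.finite_of_ncard_ne_zero (by simp [hcard])
  let f : O → Quotient (wordSetoid
      (fun l : List V => l.Nodup ∧ l.toFinset = L ∧ CompatTree G L l)) :=
    fun l => Quotient.mk _ ⟨r :: l.1, (hcons l.1).mpr l.2⟩
  have hsurj : Function.Surjective f := by
    intro q
    induction q using Quotient.inductionOn with
    | _ w =>
    obtain ⟨w, hnd, hL, hc⟩ := w
    have hrw : r ∈ w := by rw [← List.mem_toFinset, hL]; exact hr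
    obtain ⟨a, b, rfl⟩ := List.append_of_mem hrw
    have hrot : (a ++ r :: b) ~r (r :: (b ++ a)) := List.isRotated_append
    have hmem : b ++ a ∈ O := by
      refine (hcons _).mp ⟨hrot.nodup_iff.mp hnd, ?_, fun x y h => (hc x y h).of_isRotated hrot⟩
      rw [← hL]
      exact (List.toFinset_eq_of_perm _ _ hrot.perm).symm
    exact ⟨⟨b ++ a, hmem⟩, Quotient.sound (Or.inl hrot.symm)⟩
  have h2 := card_eq_two_mul_of_involutive_fibers hsurj
    (fun l => ⟨l.1.reverse, reverse_mem_linearOrders l.2⟩)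
    (fun l h => reverse_ne_self l.2.1
      (by rw [length_of_mem_linearOrders l.2, hcardA]; omega) (congrArg Subtype.val h))
    (fun l l' => by
      rw [Quotient.eq, Subtype.ext_iff, Subtype.ext_iff]
      exact dihEquiv_cons_iff_s2 ((hcons l.1).mpr l.2).1)
  rw [Nat.card_coe_set_eq, hcard, hcardA] at h2
  obtain ⟨k, hk⟩ := Nat.exists_eq_add_of_le hn
  rw [hk] at h2 ⊢
  rw [show 3 + k - 1 - 1 = k + 1 by omega, pow_succ] at h2
  rw [show 3 + k - 3 = k by omega]
  omega

end
end

section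
/- Let T be a trivalent tree with leaf set L, |L| = n ≥ 4, let e be an internal edge of T inducing the leaf partition L = A ⊔ B, and let σ be a (2,n) color ordering on L compatible with T (so both A and B are contiguous arcs of σ). Define the twist tw_e(σ) as the color ordering obtained from σ by reversing the arc A in place (as an equivalence class under rotation and reversal, the result does not depend on whether the arc A or the arc B is reversed). Then: (i) tw_e(σ) is again compatible with T; (ii) tw_e is an involution on the set of color orderings compatible with T; and (iii) for distinct internal edges e ≠ e′ of T, the maps tw_e and tw_{e′} commute on the set of color orderings compatible with T. -/
open scoped Classical

noncomputable section

/-- `l'` represents the twist of the color ordering represented by `l` along the edge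
`{u,v}`: writing `l` (up to rotation/reversal) as `a ++ b` where `a` carries exactly the
block of leaves on the `u`-side of the edge, the twist reverses the arc `a` in place. -/
def TwistRel {V : Type*} [Fintype V] [DecidableEq V] (G : SimpleGraph V) (L : Finset V)
    (u v : V) (l l' : List V) : Prop :=
  ∃ a b : List V, DihEquiv l (a ++ b) ∧ a.toFinset = leafSide G L u v ∧
    DihEquiv l' (a.reverse ++ b)

namespace DihEquiv

variable {α : Type*} {l₁ l₂ l₃ : List α}

theorem refl (l : List α) : DihEquiv l l := Or.inl (List.IsRotated.refl l)

theorem symm (h : DihEquiv l₁ l₂) : DihEquiv l₂ l₁ := by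
  rcases h with h | h
  · exact Or.inl h.symm
  · right
    simpa using h.reverse.symm

theorem trans (h₁ : DihEquiv l₁ l₂) (h₂ : DihEquiv l₂ l₃) : DihEquiv l₁ l₃ := by
  rcases h₁ with h₁ | h₁ <;> rcases h₂ with h₂ | h₂
  · exact Or.inl (h₁.trans h₂)
  · exact Or.inr (h₁.reverse.trans h₂)
  · exact Or.inr (h₁.trans h₂)
  · left
    have := h₁.reverse.trans h₂
    rwa [List.reverse_reverse] at this

theorem perm (h : DihEquiv l₁ l₂) : l₁.Perm l₂ := by
  rcases h with h | h
  · exact h.perm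
  · exact (List.reverse_perm l₁).symm.trans h.perm

end DihEquiv

theorem dihEquiv_reverse_append_reverse {α : Type*} (a b : List α) :
    DihEquiv (a.reverse ++ b) (a ++ b.reverse) :=
  Or.inr (by simpa using List.isRotated_append)

theorem List.IsRotated.exists_append_s3 {α : Type*} {l l' : List α} (h : l ~r l') :
    ∃ p q, l = p ++ q ∧ l' = q ++ p := by
  obtain ⟨n, hn, rfl⟩ := List.isRotated_iff_mod.1 h
  exact ⟨l.take n, l.drop n, (List.take_append_drop n l).symm,
    List.rotate_eq_drop_append_take hn⟩

theorem List.exists_mem_of_append_eq_append {α : Type*} {p q a b : List α}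
    (h : p ++ q = a ++ b) (hq : q ≠ []) (hb : b ≠ []) : ∃ x ∈ q, x ∈ b := by
  rcases List.append_eq_append_iff.1 h with ⟨s, -, rfl⟩ | ⟨s, -, rfl⟩
  · obtain ⟨x, hx⟩ := List.exists_mem_of_ne_nil _ hb
    exact ⟨x, by simp [hx], hx⟩
  · obtain ⟨x, hx⟩ := List.exists_mem_of_ne_nil _ hq
    exact ⟨x, hx, by simp [hx]⟩

/-- In a cyclic word without repetitions, an arc contained in a proper arc splits it linearly. -/
theorem List.IsRotated.exists_split {α : Type*} {a b c d : List α} (hn : (a ++ b).Nodup)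
    (h : (a ++ b) ~r (c ++ d)) (hca : c ⊆ a) (hc : c ≠ []) (hb : b ≠ []) :
    ∃ p q, a = p ++ c ++ q ∧ d = q ++ b ++ p := by
  have hdis : ∀ x ∈ a, x ∉ b := fun x ha hxb => (List.nodup_append.1 hn).2.2 x ha x hxb rfl
  obtain ⟨p, q, h₁, h₂⟩ := h.exists_append_s3
  rcases List.append_eq_append_iff.1 h₂ with ⟨s, rfl, rfl⟩ | ⟨s, rfl, rfl⟩
  · rw [← List.append_assoc] at h₁
    rcases List.append_eq_append_iff.1 h₁ with ⟨t, ht, rfl⟩ | ⟨t, rfl, rfl⟩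
    · rcases eq_or_ne t [] with rfl | htn
      · exact ⟨p, [], by simpa using ht.symm, by simp⟩
      · obtain ⟨x, hx, hxt⟩ := List.exists_mem_of_append_eq_append ht hc htn
        exact absurd (List.mem_append_left _ hxt) (hdis x (hca hx))
    · exact ⟨p, t, rfl, by simp⟩
  · rcases eq_or_ne q [] with rfl | hq
    · simp only [List.append_nil, List.nil_append] at *
      rcases List.append_eq_append_iff.1 h₁ with ⟨t, rfl, rfl⟩ | ⟨t, rfl, rfl⟩
      · rcases eq_or_ne t [] with rfl | ht
        · exact ⟨[], [], by simp, by simp⟩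
        · obtain ⟨x, hx⟩ := List.exists_mem_of_ne_nil _ ht
          exact absurd (by simp [hx]) (hdis x (hca (by simp [hx])))
      · exact ⟨[], t, by simp, by simp⟩
    · obtain ⟨x, hx, hxb⟩ := List.exists_mem_of_append_eq_append h₁.symm hq hb
      exact absurd hxb (hdis x (hca (by simp [hx])))

section Arc

variable {α : Type*} [DecidableEq α] {l l' : List α} {A C : Finset α}

theorem isArc_iff_s3 : IsArc l C ↔ ∃ c d, l ~r (c ++ d) ∧ c.toFinset = C := by
  constructor
  · rintro ⟨m, k, h⟩
    exact ⟨_, (l.rotate m).drop k, ⟨m, (List.take_append_drop k _).symm⟩, h⟩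
  · rintro ⟨c, d, ⟨m, hm⟩, h⟩
    exact ⟨m, c.length, by rw [hm, List.take_left]; exact h⟩

theorem IsArc.of_dihEquiv (h : IsArc l C) (e : DihEquiv l l') : IsArc l' C := by
  rw [isArc_iff_s3] at *
  obtain ⟨c, d, hr, hc⟩ := h
  rcases e with e | e
  · exact ⟨c, d, e.symm.trans hr, hc⟩
  · refine ⟨c.reverse, d.reverse, e.symm.trans (hr.reverse.trans ?_), by simpa using hc⟩
    rw [List.reverse_append]
    exact List.isRotated_append

theorem IsArc.compl_s3 (hl : l.Nodup) (h : IsArc l C) : IsArc l (l.toFinset \ C) := by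
  rw [isArc_iff_s3] at *
  obtain ⟨c, d, hr, rfl⟩ := h
  refine ⟨d, c, hr.trans List.isRotated_append, ?_⟩
  have hn := hr.nodup_iff.1 hl
  rw [List.nodup_append] at hn
  ext x
  have := hr.mem_iff (a := x)
  simp only [List.mem_toFinset, Finset.mem_sdiff, this, List.mem_append]
  grind

theorem IsArc.exists_nested (hl : l.Nodup) (hA : IsArc l A) (hC : IsArc l C) (h : C ⊆ A) :
    ∃ p c q b, l ~r (p ++ c ++ q ++ b) ∧ c.toFinset = C ∧ (p ++ c ++ q).toFinset = A := by
  rw [isArc_iff_s3] at hA hC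
  obtain ⟨a, b, hab, rfl⟩ := hA
  obtain ⟨c, d, hcd, rfl⟩ := hC
  have hn := hab.nodup_iff.1 hl
  have hsub : ∀ x ∈ c, x ∈ a := by
    intro x hx
    simpa using h (by simpa using hx)
  rcases eq_or_ne b [] with rfl | hb
  · refine ⟨[], c, d, [], by simpa using hcd, rfl, ?_⟩
    ext x
    have h₁ := hab.mem_iff (a := x)
    have h₂ := hcd.mem_iff (a := x)
    simp at *
    tauto
  rcases eq_or_ne c [] with rfl | hc
  · exact ⟨a, [], [], b, by simpa using hab, rfl, by simp⟩
  obtain ⟨p, q, rfl, -⟩ := List.IsRotated.exists_split hn (hab.symm.trans hcd) hsub hc hb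
  exact ⟨p, c, q, b, hab, rfl, rfl⟩

end Arc

section Twist

variable {α : Type*} [DecidableEq α] {l l' l₁ l₂ : List α} {A C : Finset α}

theorem List.IsRotated.dihEquiv_reverse_append {a b c d : List α} (hn : (a ++ b).Nodup)
    (h : (a ++ b) ~r (c ++ d)) (hac : a.toFinset = c.toFinset) :
    DihEquiv (a.reverse ++ b) (c.reverse ++ d) := by
  have hn' := h.nodup_iff.1 hn
  have hmem : ∀ x, x ∈ a ↔ x ∈ c := fun x => by simpa using Finset.ext_iff.1 hac x
  have hmem' : ∀ x, x ∈ b ↔ x ∈ d := by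
    intro x
    have h₁ := h.mem_iff (a := x)
    have h₂ := hmem x
    rw [List.nodup_append] at hn hn'
    simp only [List.mem_append] at h₁
    grind
  rcases eq_or_ne b [] with rfl | hb
  · obtain rfl : d = [] := List.eq_nil_iff_forall_not_mem.2 fun x hx => by
      simpa using (hmem' x).2 hx
    simp only [List.append_nil] at *
    exact Or.inl h.reverse
  rcases eq_or_ne c [] with rfl | hc
  · obtain rfl : a = [] := List.eq_nil_iff_forall_not_mem.2 fun x hx => by
      simpa using (hmem x).1 hx
    exact Or.inl h
  obtain ⟨p, q, rfl, rfl⟩ := h.exists_split hn (fun x hx => (hmem x).2 hx) hc hb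
  have hp : p = [] := List.eq_nil_iff_forall_not_mem.2 fun x hx => by
    have := (hmem x).1 (by simp [hx])
    simp only [List.nodup_append, List.mem_append] at hn
    grind
  have hq : q = [] := List.eq_nil_iff_forall_not_mem.2 fun x hx => by
    have := (hmem x).1 (by simp [hx])
    simp only [List.nodup_append, List.mem_append] at hn
    grind
  subst hp hq
  simpa using DihEquiv.refl _

/-- `l'` is obtained, up to dihedral equivalence, from `l` by reversing the arc with
label set `A`. -/
def ArcTwist (A : Finset α) (l l' : List α) : Prop :=
  ∃ a b : List α, DihEquiv l (a ++ b) ∧ a.toFinset = A ∧ DihEquiv l' (a.reverse ++ b)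

namespace ArcTwist

theorem congr_left (h : ArcTwist A l l') (e : DihEquiv l l₁) : ArcTwist A l₁ l' := by
  obtain ⟨a, b, h₁, h₂, h₃⟩ := h
  exact ⟨a, b, e.symm.trans h₁, h₂, h₃⟩

theorem symm (h : ArcTwist A l l') : ArcTwist A l' l := by
  obtain ⟨a, b, h₁, h₂, h₃⟩ := h
  exact ⟨a.reverse, b, h₃, by simpa using h₂, by simpa using h₁⟩

theorem perm (h : ArcTwist A l l') : l.Perm l' := by
  obtain ⟨a, b, h₁, -, h₃⟩ := h
  exact h₁.perm.trans ((((List.reverse_perm a).append_right b).symm).trans h₃.perm.symm)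

theorem unique (hl : l.Nodup) (h₁ : ArcTwist A l l₁) (h₂ : ArcTwist A l l₂) :
    DihEquiv l₁ l₂ := by
  obtain ⟨a, b, hab, hA, e₁⟩ := h₁
  obtain ⟨c, d, hcd, hC, e₂⟩ := h₂
  have hn := hab.perm.nodup_iff.1 hl
  refine e₁.trans (DihEquiv.trans ?_ e₂.symm)
  rcases hab.symm.trans hcd with h | h
  · exact h.dihEquiv_reverse_append hn (hA.trans hC.symm)
  · have h' : (a.reverse ++ b.reverse) ~r (c ++ d) := by
      refine List.isRotated_append.trans ?_
      rwa [← List.reverse_append]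
    refine (dihEquiv_reverse_append_reverse a b).trans ?_
    have := h'.dihEquiv_reverse_append
      (h'.nodup_iff.2 (hcd.perm.nodup_iff.1 hl)) (by simpa using hA.trans hC.symm)
    simpa using this

theorem compl_s3 (hl : l.Nodup) (h : ArcTwist A l l') : ArcTwist (l.toFinset \ A) l l' := by
  obtain ⟨a, b, h₁, rfl, h₃⟩ := h
  have hn := List.nodup_append.1 (h₁.perm.nodup_iff.1 hl)
  refine ⟨b, a, h₁.trans (Or.inl List.isRotated_append), ?_, h₃.trans ?_⟩
  · ext x
    have := h₁.perm.mem_iff (a := x)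
    simp only [List.mem_toFinset, Finset.mem_sdiff, this, List.mem_append]
    grind
  · exact (dihEquiv_reverse_append_reverse a b).trans (Or.inl List.isRotated_append)

theorem of_isRotated {a c d : List α} (h : l ~r (c ++ a ++ d))
    (h' : l' ~r (c ++ a.reverse ++ d)) (hA : a.toFinset = A) : ArcTwist A l l' := by
  have key : ∀ x : List α, (c ++ x ++ d) ~r (x ++ (d ++ c)) := fun x => by
    rw [List.append_assoc, ← List.append_assoc x]
    exact List.isRotated_append
  exact ⟨a, d ++ c, Or.inl (h.trans (key a)), hA, Or.inl (h'.trans (key _))⟩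

theorem exists_of_isArc (h : IsArc l A) : ∃ l', ArcTwist A l l' := by
  obtain ⟨a, b, h, hA⟩ := isArc_iff_s3.1 h
  exact ⟨a.reverse ++ b, a, b, Or.inl h, hA, DihEquiv.refl _⟩

theorem isArc_left (h : ArcTwist A l l') : IsArc l A := by
  obtain ⟨a, b, h, hA, -⟩ := h
  exact (isArc_iff_s3.2 ⟨a, b, List.IsRotated.refl _, hA⟩).of_dihEquiv h.symm

theorem isArc_of_subset (hl : l.Nodup) (h : ArcTwist A l l') (hAC : A ⊆ C) (hC : IsArc l C) :
    IsArc l' C := by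
  obtain ⟨p, a, q, b, hr, hA, hC'⟩ := hC.exists_nested hl h.isArc_left hAC
  have ht : ArcTwist A l (p ++ a.reverse ++ q ++ b) :=
    of_isRotated (c := p) (d := q ++ b) (by simpa using hr) (by simp [List.IsRotated.refl]) hA
  refine IsArc.of_dihEquiv ?_ (ht.unique hl h)
  exact isArc_iff_s3.2 ⟨p ++ a.reverse ++ q, b, List.IsRotated.refl _, by simpa using hC'⟩

theorem comm_of_subset (hl : l.Nodup) (hAC : A ⊆ C) {p q r t : List α}
    (hp : ArcTwist A l p) (hq : ArcTwist C p q) (hr : ArcTwist C l r) (ht : ArcTwist A r t) :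
    DihEquiv q t := by
  obtain ⟨x, a, y, b, hrot, hA, hC⟩ := hr.isArc_left.exists_nested hl hp.isArc_left hAC
  set m := y.reverse ++ a ++ x.reverse ++ b
  have hp' : ArcTwist A l (x ++ a.reverse ++ y ++ b) :=
    of_isRotated (c := x) (d := y ++ b) (by simpa using hrot) (by simp [List.IsRotated.refl]) hA
  have hr' : ArcTwist C l (y.reverse ++ a.reverse ++ x.reverse ++ b) :=
    of_isRotated (c := []) (d := b) (by simpa using hrot) (by simp [List.IsRotated.refl]) hC
  have hq' : ArcTwist C (x ++ a.reverse ++ y ++ b) m :=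
    of_isRotated (a := x ++ a.reverse ++ y) (c := []) (d := b) (by simp [List.IsRotated.refl])
      (by simp [m, List.IsRotated.refl])
      (by simpa using hC)
  have ht' : ArcTwist A (y.reverse ++ a.reverse ++ x.reverse ++ b) m :=
    of_isRotated (a := a.reverse) (c := y.reverse) (d := x.reverse ++ b) (by simp [List.IsRotated.refl])
      (by simp [m, List.IsRotated.refl]) (by simpa using hA)
  have hqm := unique (hp.perm.nodup_iff.1 hl) hq (hq'.congr_left (hp'.unique hl hp))
  have htm := unique (hr.perm.nodup_iff.1 hl) ht (ht'.congr_left (hr'.unique hl hr))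
  exact hqm.trans htm.symm

end ArcTwist

end Twist

section Tree

variable {V : Type*} {G : SimpleGraph V}

theorem SimpleGraph.Connected.reachable_deleteEdges_or (hG : G.Connected) (u v w : V) :
    (G.deleteEdges {s(u, v)}).Reachable u w ∨ (G.deleteEdges {s(u, v)}).Reachable v w := by
  obtain ⟨W⟩ := hG.preconnected w u
  induction W with
  | nil => exact Or.inl (SimpleGraph.Reachable.refl _)
  | @cons x y z hxy _ ih =>
    by_cases h : s(x, y) = s(z, v)
    · rcases Sym2.eq_iff.1 h with ⟨rfl, -⟩ | ⟨rfl, -⟩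
      · exact Or.inl (SimpleGraph.Reachable.refl _)
      · exact Or.inr (SimpleGraph.Reachable.refl _)
    · have hadj : (G.deleteEdges {s(z, v)}).Adj y x := by
        rw [SimpleGraph.deleteEdges_adj]
        exact ⟨hxy.symm, by rwa [Set.mem_singleton_iff, Sym2.eq_swap]⟩
      exact ih.imp (·.trans hadj.reachable) (·.trans hadj.reachable)

theorem SimpleGraph.IsTree.reachable_deleteEdges_iff (hG : G.IsTree) {u v : V}
    (h : G.Adj u v) (w : V) : (G.deleteEdges {s(u, v)}).Reachable v w ↔
      ¬ (G.deleteEdges {s(u, v)}).Reachable u w := by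
  refine ⟨fun h₁ h₂ => ?_, (hG.connected.reachable_deleteEdges_or u v w).resolve_left⟩
  exact SimpleGraph.isBridge_iff.1 (SimpleGraph.isAcyclic_iff_forall_adj_isBridge.1 hG.isAcyclic h)
    (h₂.trans h₁.symm)

theorem SimpleGraph.Reachable.deleteEdges_of_not_reachable {E F : Set (Sym2 V)} {v w : V}
    (h : (G.deleteEdges E).Reachable v w)
    (hF : ∀ x y, s(x, y) ∈ F → ¬ (G.deleteEdges E).Reachable v x) :
    (G.deleteEdges F).Reachable v w := by
  rw [SimpleGraph.reachable_iff_reflTransGen] at h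
  induction h with
  | refl => exact SimpleGraph.Reachable.refl _
  | @tail a b hva hab ih =>
    rw [← SimpleGraph.reachable_iff_reflTransGen] at hva
    refine ih.trans (SimpleGraph.Adj.reachable ?_)
    rw [SimpleGraph.deleteEdges_adj] at hab ⊢
    exact ⟨hab.1, fun hm => hF a b hm hva⟩

variable [Fintype V] [DecidableEq V] {L : Finset V}

theorem leafSide_swap (hG : G.IsTree) {u v : V} (h : G.Adj u v) :
    leafSide G L v u = L \ leafSide G L u v := by
  ext w
  have := hG.reachable_deleteEdges_iff h w
  rw [Sym2.eq_swap] at this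
  simp only [leafSide, Finset.mem_filter, Finset.mem_sdiff, this]
  rw [Sym2.eq_swap]
  tauto

theorem leafSide_subset_of_reachable {u v x y : V}
    (hv : (G.deleteEdges {s(x, y)}).Reachable x v)
    (hx : ¬ (G.deleteEdges {s(u, v)}).Reachable v x)
    (hy : ¬ (G.deleteEdges {s(u, v)}).Reachable v y) :
    leafSide G L v u ⊆ leafSide G L x y := by
  intro w hw
  simp only [leafSide, Finset.mem_filter] at hw ⊢
  refine ⟨hw.1, hv.trans ?_⟩
  rw [Sym2.eq_swap] at hw
  refine hw.2.deleteEdges_of_not_reachable fun a b hab => ?_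
  rcases Sym2.eq_iff.1 hab with ⟨rfl, -⟩ | ⟨rfl, -⟩ <;> assumption

/-- The leaf bipartitions of two edges of a tree are nested. -/
theorem exists_leafSide_subset (hG : G.IsTree) {u v x y : V} (huv : G.Adj u v)
    (hxy : G.Adj x y) :
    leafSide G L u v ⊆ leafSide G L x y ∨ leafSide G L u v ⊆ leafSide G L y x ∨
      leafSide G L v u ⊆ leafSide G L x y ∨ leafSide G L v u ⊆ leafSide G L y x := by
  by_cases he : s(u, v) = s(x, y)
  · rcases Sym2.eq_iff.1 he with ⟨rfl, rfl⟩ | ⟨rfl, rfl⟩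
    · exact Or.inl subset_rfl
    · exact Or.inr (Or.inl subset_rfl)
  have hside : ((G.deleteEdges {s(u, v)}).Reachable u x ∧
      (G.deleteEdges {s(u, v)}).Reachable u y) ∨
      ((G.deleteEdges {s(u, v)}).Reachable v x ∧ (G.deleteEdges {s(u, v)}).Reachable v y) := by
    have hadj : (G.deleteEdges {s(u, v)}).Adj x y := by
      rw [SimpleGraph.deleteEdges_adj]
      exact ⟨hxy, fun h => he (Set.mem_singleton_iff.1 h).symm⟩
    exact (hG.connected.reachable_deleteEdges_or u v x).imp
      (fun h => ⟨h, h.trans hadj.reachable⟩) fun h => ⟨h, h.trans hadj.reachable⟩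
  rcases hside with ⟨hx, hy⟩ | ⟨hx, hy⟩
  · have hx' := mt (hG.reachable_deleteEdges_iff huv x).1 (not_not.2 hx)
    have hy' := mt (hG.reachable_deleteEdges_iff huv y).1 (not_not.2 hy)
    rcases hG.connected.reachable_deleteEdges_or x y v with h | h
    · exact Or.inr (Or.inr (Or.inl (leafSide_subset_of_reachable h hx' hy')))
    · rw [Sym2.eq_swap] at h
      exact Or.inr (Or.inr (Or.inr (leafSide_subset_of_reachable h hy' hx')))
  · have hx' := (hG.reachable_deleteEdges_iff huv x).1 hx
    have hy' := (hG.reachable_deleteEdges_iff huv y).1 hy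
    rw [Sym2.eq_swap] at hx' hy'
    rcases hG.connected.reachable_deleteEdges_or x y u with h | h
    · exact Or.inl (leafSide_subset_of_reachable h hx' hy')
    · rw [Sym2.eq_swap] at h
      exact Or.inr (Or.inl (leafSide_subset_of_reachable h hy' hx'))

theorem TwistRel.swap (hG : G.IsTree) {u v : V} (huv : G.Adj u v) {l l' : List V}
    (hl : l.Nodup) (hL : l.toFinset = L) (h : TwistRel G L u v l l') :
    TwistRel G L v u l l' := by
  have := ArcTwist.compl_s3 hl h
  rwa [hL, ← leafSide_swap hG huv] at this

theorem TwistRel.compatTree (hG : G.IsTree) {u v : V} (huv : G.Adj u v) {l l' : List V}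
    (hl : l.Nodup) (hL : l.toFinset = L) (hc : CompatTree G L l) (h : TwistRel G L u v l l') :
    CompatTree G L l' := by
  have hp := ArcTwist.perm h
  have hl' := hp.nodup_iff.1 hl
  have hL' : l'.toFinset = L := (List.toFinset_eq_of_perm _ _ hp).symm.trans hL
  intro x y hxy
  have hback : IsArc l' (leafSide G L y x) → IsArc l' (leafSide G L x y) := fun ha => by
    rw [leafSide_swap hG hxy.symm, ← hL']
    rw [← hL'] at ha
    exact ha.compl_s3 hl'
  have h' := h.swap hG huv hl hL
  rcases exists_leafSide_subset (L := L) hG huv hxy with hs | hs | hs | hs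
  · exact ArcTwist.isArc_of_subset hl h hs (hc _ _ hxy)
  · exact hback (ArcTwist.isArc_of_subset hl h hs (hc _ _ hxy.symm))
  · exact ArcTwist.isArc_of_subset hl h' hs (hc _ _ hxy)
  · exact hback (ArcTwist.isArc_of_subset hl h' hs (hc _ _ hxy.symm))

theorem TwistRel.comm (hG : G.IsTree) {u v x y : V} (huv : G.Adj u v) (hxy : G.Adj x y)
    {l p q r t : List V} (hl : l.Nodup) (hL : l.toFinset = L)
    (hp : TwistRel G L u v l p) (hq : TwistRel G L x y p q)
    (hr : TwistRel G L x y l r) (ht : TwistRel G L u v r t) : DihEquiv q t := by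
  have hlp := ArcTwist.perm hp
  have hlr := ArcTwist.perm hr
  have hp' := hp.swap hG huv hl hL
  have hr' := hr.swap hG hxy hl hL
  have hq' := hq.swap hG hxy (hlp.nodup_iff.1 hl)
    ((List.toFinset_eq_of_perm _ _ hlp).symm.trans hL)
  have ht' := ht.swap hG huv (hlr.nodup_iff.1 hl)
    ((List.toFinset_eq_of_perm _ _ hlr).symm.trans hL)
  rcases exists_leafSide_subset (L := L) hG huv hxy with hs | hs | hs | hs
  · exact ArcTwist.comm_of_subset hl hs hp hq hr ht
  · exact ArcTwist.comm_of_subset hl hs hp hq' hr' ht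
  · exact ArcTwist.comm_of_subset hl hs hp' hq hr ht'
  · exact ArcTwist.comm_of_subset hl hs hp' hq' hr' ht'

end Tree

/-- Properties of the twist operation along an internal edge `{u,v}` of a trivalent tree
`G` with leaf set `L`, acting on color orderings compatible with `G`:
the twist exists, it is well defined on color orderings (independent of all choices, and
of whether the arc `A` or the complementary arc `B` is reversed), it preserves
compatibility with `G`, it is an involution, and twists along distinct internal edges
commute. -/
theorem twist_properties {V : Type*} [Fintype V] [DecidableEq V]
    (G : SimpleGraph V) (L : Finset V) (hn : 4 ≤ L.card) (hG : IsTrivalentTree G L)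
    (u v : V) (he : G.Adj u v) (hu : u ∉ L) (hv : v ∉ L)
    (l : List V) (hl : l.Nodup ∧ l.toFinset = L ∧ CompatTree G L l) :
    -- the twist exists
    (∃ l', TwistRel G L u v l l') ∧
    -- it is well defined as a color ordering
    (∀ l₁ l₂, TwistRel G L u v l l₁ → TwistRel G L u v l l₂ → DihEquiv l₁ l₂) ∧
    -- reversing the complementary arc gives the same color ordering
    (∀ l₁ l₂, TwistRel G L u v l l₁ → TwistRel G L v u l l₂ → DihEquiv l₁ l₂) ∧
    -- (i) the twist is again compatible with `G`
    (∀ l', TwistRel G L u v l l' → l'.Nodup ∧ l'.toFinset = L ∧ CompatTree G L l') ∧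
    -- (ii) the twist is an involution
    (∀ l' l'', TwistRel G L u v l l' → TwistRel G L u v l' l'' → DihEquiv l l'') ∧
    -- (iii) twists along distinct internal edges commute
    (∀ u' v' : V, G.Adj u' v' → u' ∉ L → v' ∉ L → s(u, v) ≠ s(u', v') →
      ∀ p q r t : List V, TwistRel G L u v l p → TwistRel G L u' v' p q →
        TwistRel G L u' v' l r → TwistRel G L u v r t → DihEquiv q t) := by
  obtain ⟨hnd, hL, hc⟩ := hl
  have hT := hG.1
  refine ⟨ArcTwist.exists_of_isArc (hc u v he), fun l₁ l₂ h₁ h₂ => ArcTwist.unique hnd h₁ h₂,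
    fun l₁ l₂ h₁ h₂ => ArcTwist.unique hnd h₁ (h₂.swap hT he.symm hnd hL), fun l' h => ?_,
    fun l' l'' h₁ h₂ => ?_, fun u' v' he' _ _ _ p q r t hp hq hr ht =>
      TwistRel.comm hT he he' hnd hL hp hq hr ht⟩
  · have hp := ArcTwist.perm h
    exact ⟨hp.nodup_iff.1 hnd, (List.toFinset_eq_of_perm _ _ hp).symm.trans hL,
      h.compatTree hT he hnd hL hc⟩
  · exact ArcTwist.unique ((ArcTwist.perm h₁).nodup_iff.1 hnd) (ArcTwist.symm h₁) h₂


end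
end

section
/- Fix k ≥ 3 and n ≥ k+2. The descendant of every (2,n) color ordering σ on {1,…,n} — the (k,n) pre-GCO whose component at each (k−2)-element subset I is the restriction σ|_{[n]∖I} — is a (k,n) pseudo-GCO. Moreover, distinct (2,n) color orderings have distinct descendants. Consequently, there are exactly (n−1)!/2 descendant ('type 0') (k,n) pseudo-GCOs. -/
/-- A `(k, S.card)` pre-GCO on the label set `S`, given by representatives: to every
`(k-2)`-element subset `I ⊆ S` it assigns a cyclic word on `S \ I` (a representative of
a `(2, S.card - k + 2)` color ordering).  Values of `σ` on other subsets are irrelevant. -/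
def IsPreGCO (k : ℕ) (S : Finset ℕ) (σ : Finset ℕ → List ℕ) : Prop :=
  ∀ I : Finset ℕ, I ⊆ S → I.card = k - 2 →
    (σ I).Nodup ∧ (σ I).toFinset = S \ I

/-- The recursive pseudo-GCO condition on a `(k, S.card)` pre-GCO (given by
representatives).  For `S.card = k + 2` it says that the pre-GCO is the descendant of a
`(2, k+2)` color ordering (represented by `base`); for `S.card > k + 2` it requires all
`k`-preserving projections (delete the component at subsets containing `i`, and delete
the label `i` from the remaining components) to be pseudo-GCOs. -/
def IsPseudoGCO (k : ℕ) (S : Finset ℕ) (σ : Finset ℕ → List ℕ) : Prop :=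
  if S.card ≤ k + 2 then
    ∃ base : List ℕ, base.Nodup ∧ base.toFinset = S ∧
      ∀ I : Finset ℕ, I ⊆ S → I.card = k - 2 →
        DihEquiv (σ I) (base.filter (fun x => x ∉ I))
  else
    ∀ i ∈ S, IsPseudoGCO k (S.erase i) (fun I => (σ I).filter (fun x => x ≠ i))
termination_by S.card
decreasing_by exact Finset.card_erase_lt_of_mem ‹_›

/-- Setoid identifying two `(k, S.card)` pre-GCO representatives when all of their
relevant components are dihedrally equivalent, i.e. when they represent the same
generalized color ordering. -/
def gcoSetoid (k : ℕ) (S : Finset ℕ) (P : (Finset ℕ → List ℕ) → Prop) :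
    Setoid {σ : Finset ℕ → List ℕ // P σ} where
  r σ τ := ∀ I : Finset ℕ, I ⊆ S → I.card = k - 2 → DihEquiv (σ.1 I) (τ.1 I)
  iseqv :=
    ⟨fun σ I _ _ => dihEquiv_refl (σ.1 I),
     fun h I hI hc => dihEquiv_symm (h I hI hc),
     fun h h' I hI hc => dihEquiv_trans (h I hI hc) (h' I hI hc)⟩

theorem List.isRotated_iff_exists_append {α : Type*} {l₁ l₂ : List α} :
    l₁ ~r l₂ ↔ ∃ s t, l₁ = s ++ t ∧ l₂ = t ++ s := by
  constructor
  · rintro ⟨m, rfl⟩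
    refine ⟨l₁.take (m % l₁.length), l₁.drop (m % l₁.length), ?_, ?_⟩
    · simp
    · exact List.rotate_eq_drop_append_take_mod
  · rintro ⟨s, t, rfl, rfl⟩
    exact List.isRotated_append

theorem List.IsRotated.filter' {α : Type*} {l₁ l₂ : List α} (h : l₁ ~r l₂) (p : α → Bool) :
    l₁.filter p ~r l₂.filter p := by
  obtain ⟨s, t, rfl, rfl⟩ := List.isRotated_iff_exists_append.1 h
  simpa only [List.filter_append] using List.isRotated_append

theorem DihEquiv.filter {α : Type*} {l₁ l₂ : List α} (h : DihEquiv l₁ l₂) (p : α → Bool) :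
    DihEquiv (l₁.filter p) (l₂.filter p) := by
  rcases h with h | h
  · exact Or.inl (h.filter' p)
  · refine Or.inr ?_
    rw [← List.filter_reverse]
    exact h.filter' p

theorem List.IsRotated.eq_of_cons {α : Type*} {a : α} {u v : List α} (hu : (a :: u).Nodup)
    (h : (a :: u) ~r (a :: v)) : u = v := by
  obtain ⟨s, t, h₁, h₂⟩ := List.isRotated_iff_exists_append.1 h
  rcases s with _ | ⟨b, s⟩
  · rw [List.append_nil] at h₂
    exact List.tail_eq_of_cons_eq (h₁.trans h₂.symm)
  rcases t with _ | ⟨c, t⟩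
  · rw [List.append_nil] at h₁
    exact List.tail_eq_of_cons_eq (h₁.trans h₂.symm)
  · simp only [List.cons_append, List.cons.injEq] at h₁ h₂
    obtain ⟨rfl, rfl⟩ := h₁
    obtain ⟨rfl, rfl⟩ := h₂
    simp at hu

theorem DihEquiv.eq_or_reverse_eq_of_cons {α : Type*} {a : α} {u v : List α}
    (hu : (a :: u).Nodup) (h : DihEquiv (a :: u) (a :: v)) : u = v ∨ u.reverse = v := by
  rcases h with h | h
  · exact Or.inl (h.eq_of_cons hu)
  · have h' : (a :: u.reverse) ~r (a :: v) := by
      refine List.IsRotated.trans ?_ h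
      rw [List.reverse_cons]
      exact List.isRotated_append (l := [a]) (l' := u.reverse)
    refine Or.inr (h'.eq_of_cons ?_)
    simpa using hu

theorem dihEquiv_cons_reverse {α : Type*} (a : α) (u : List α) :
    DihEquiv (a :: u) (a :: u.reverse) := by
  refine Or.inr ?_
  rw [List.reverse_cons]
  exact List.isRotated_append (l := u.reverse) (l' := [a])

theorem List.exists_isRotated_cons {α : Type*} {a : α} {l : List α} (h : a ∈ l) :
    ∃ u, l ~r (a :: u) := by
  obtain ⟨s, t, rfl⟩ := List.append_of_mem h
  exact ⟨t ++ s, List.isRotated_append⟩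

theorem List.pair_sublist_or {α : Type*} {l : List α} {x y : α} (hx : x ∈ l) (hy : y ∈ l)
    (hxy : x ≠ y) : [x, y].Sublist l ∨ [y, x].Sublist l := by
  obtain ⟨s, t, rfl⟩ := List.append_of_mem hx
  have : y ∈ s ∨ y ∈ t := by simpa [hxy.symm] using hy
  rcases this with h | h
  · right
    exact (List.singleton_sublist.2 h).append (List.singleton_sublist.2 List.mem_cons_self)
  · left
    exact ((List.singleton_sublist.2 h).cons_cons x).trans (List.sublist_append_right _ _)

theorem List.Nodup.not_pair_sublist {α : Type*} {l : List α} (hl : l.Nodup) {x y : α}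
    (h : [x, y].Sublist l) : ¬ [y, x].Sublist l := by
  induction l with
  | nil => simp at h
  | cons a l ih =>
    intro h'
    rw [List.nodup_cons] at hl
    have h₁ := List.sublist_cons_iff.1 h
    have h₂ := List.sublist_cons_iff.1 h'
    rcases h₁ with h₁ | ⟨r, hr, h₁⟩ <;> rcases h₂ with h₂ | ⟨r', hr', h₂⟩
    · exact ih hl.2 h₁ h₂
    · simp only [List.cons.injEq] at hr'
      exact hl.1 (hr'.1 ▸ h₁.subset (by simp))
    · simp only [List.cons.injEq] at hr
      exact hl.1 (hr.1 ▸ h₂.subset (by simp))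
    · simp only [List.cons.injEq] at hr hr'
      obtain ⟨rfl, rfl⟩ := hr
      obtain ⟨rfl, rfl⟩ := hr'
      exact hl.1 (List.singleton_sublist.1 h₁)

theorem List.pair_sublist_filter_iff {α : Type*} {l : List α} {p : α → Bool} {x y : α}
    (hx : p x) (hy : p y) : [x, y].Sublist (l.filter p) ↔ [x, y].Sublist l := by
  constructor
  · exact fun h => h.trans List.filter_sublist
  · intro h
    simpa [hx, hy] using h.filter p

theorem List.pair_sublist_reverse_iff {α : Type*} {l : List α} {x y : α} :
    [x, y].Sublist l.reverse ↔ [y, x].Sublist l := by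
  rw [← List.reverse_sublist]
  simp

/-- A list without repetition is determined by the relative order of its elements. -/
theorem List.Nodup.eq_of_pair_sublist {α : Type*} {l₁ l₂ : List α} (h₁ : l₁.Nodup)
    (hp : l₁.Perm l₂) (h : ∀ x y, [x, y].Sublist l₁ → [x, y].Sublist l₂) : l₁ = l₂ := by
  have h₂ : l₂.Nodup := hp.nodup_iff.1 h₁
  have key : ∀ x y, [x, y].Sublist l₂ → [x, y].Sublist l₁ := by
    intro x y hxy
    have hne : x ≠ y := by simpa using hxy.nodup h₂
    rcases List.pair_sublist_or (hp.mem_iff.2 (hxy.subset (by simp)))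
      (hp.mem_iff.2 (hxy.subset (by simp))) hne with h' | h'
    · exact h'
    · exact absurd (h _ _ h') (h₂.not_pair_sublist hxy)
  refine hp.eq_of_pairwise (le := fun x y => [x, y].Sublist l₁) ?_ ?_ ?_
  · exact fun a b _ _ hab hba => absurd hba (h₁.not_pair_sublist hab)
  · exact List.pairwise_iff_forall_sublist.2 fun h => h
  · exact List.pairwise_iff_forall_sublist.2 fun h => key _ _ h

/-- A linear order is determined up to reversal by its restrictions, up to reversal, to
triples. -/
theorem List.Nodup.eq_or_reverse_eq_of_triples {α : Type*} {l₁ l₂ : List α} (h₁ : l₁.Nodup)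
    (hp : l₁.Perm l₂)
    (H : ∀ x ∈ l₁, ∀ y ∈ l₁, ∀ z ∈ l₁, ∃ p : α → Bool, p x ∧ p y ∧ p z ∧
      (l₁.filter p = l₂.filter p ∨ (l₁.filter p).reverse = l₂.filter p)) :
    l₁ = l₂ ∨ l₁.reverse = l₂ := by
  have h₂ : l₂.Nodup := hp.nodup_iff.1 h₁
  have key : ∀ x ∈ l₁, ∀ y ∈ l₁, ∀ z ∈ l₁,
      (∀ u ∈ [x, y, z], ∀ v ∈ [x, y, z], [u, v].Sublist l₁ ↔ [u, v].Sublist l₂) ∨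
      (∀ u ∈ [x, y, z], ∀ v ∈ [x, y, z], [u, v].Sublist l₁ ↔ [v, u].Sublist l₂) := by
    intro x hx y hy z hz
    obtain ⟨p, px, py, pz, h | h⟩ := H x hx y hy z hz
    · left
      intro u hu v hv
      have pu : p u := by simp at hu; rcases hu with rfl | rfl | rfl <;> assumption
      have pv : p v := by simp at hv; rcases hv with rfl | rfl | rfl <;> assumption
      rw [← List.pair_sublist_filter_iff pu pv, h, List.pair_sublist_filter_iff pu pv]
    · right
      intro u hu v hv
      have pu : p u := by simp at hu; rcases hu with rfl | rfl | rfl <;> assumption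
      have pv : p v := by simp at hv; rcases hv with rfl | rfl | rfl <;> assumption
      rw [← List.pair_sublist_filter_iff pu pv, ← List.pair_sublist_filter_iff pv pu, ← h,
        List.pair_sublist_reverse_iff]
  by_cases hex : ∃ x y, [x, y].Sublist l₁ ∧ [x, y].Sublist l₂
  · obtain ⟨x, y, hxy₁, hxy₂⟩ := hex
    left
    have hx : x ∈ l₁ := hxy₁.subset (by simp)
    have hy : y ∈ l₁ := hxy₁.subset (by simp)
    have hne : x ≠ y := by simpa using hxy₁.nodup h₁
    have agree : ∀ u ∈ l₁, ∀ v ∈ [x, u], [v, u].Sublist l₁ ↔ [v, u].Sublist l₂ := by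
      intro u hu v hv
      rcases key x hx y hy u hu with h | h
      · exact h v (by simp at hv ⊢; tauto) u (by simp)
      · exact absurd ((h x (by simp) y (by simp)).1 hxy₁) (h₂.not_pair_sublist hxy₂)
    refine h₁.eq_of_pair_sublist hp fun u v huv => ?_
    have hu : u ∈ l₁ := huv.subset (by simp)
    have hv : v ∈ l₁ := huv.subset (by simp)
    have huv' : u ≠ v := by simpa using huv.nodup h₁
    rcases key x hx u hu v hv with h | h
    · exact (h u (by simp) v (by simp)).1 huv
    · rcases eq_or_ne x u with rfl | hxu
      · exact (agree v hv x (by simp)).1 huv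
      · have h₃ := agree u hu x (by simp)
        have h₄ := h x (by simp) u (by simp)
        have h₅ := h u (by simp) x (by simp)
        rcases List.pair_sublist_or hx hu hxu with h₆ | h₆
        · exact absurd (h₄.1 h₆) (h₂.not_pair_sublist (h₃.1 h₆))
        · have h₇ := h₅.1 h₆
          exact absurd (h₃.2 h₇) (h₁.not_pair_sublist h₆)
  · right
    refine List.Nodup.eq_of_pair_sublist (List.nodup_reverse.2 h₁)
      ((List.reverse_perm l₁).trans hp) fun u v huv => ?_
    rw [List.pair_sublist_reverse_iff] at huv
    have hne : v ≠ u := by simpa using huv.nodup h₁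
    rcases List.pair_sublist_or (hp.mem_iff.1 (huv.subset (by simp : v ∈ [v, u])))
      (hp.mem_iff.1 (huv.subset (by simp : u ∈ [v, u]))) hne with h | h
    · exact absurd ⟨v, u, huv, h⟩ hex
    · exact h

/-- A color ordering is determined by its restrictions to the complements of the
`m`-element sets of labels, as long as these complements have at least four elements. -/
theorem dihEquiv_of_restrictions {α : Type*} [DecidableEq α] {m : ℕ} {S : Finset α}
    (hS : m + 4 ≤ S.card) {l₁ l₂ : List α} (h₁ : l₁.Nodup) (hS₁ : l₁.toFinset = S)
    (h₂ : l₂.Nodup) (hS₂ : l₂.toFinset = S)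
    (H : ∀ I : Finset α, I ⊆ S → I.card = m →
      DihEquiv (l₁.filter (fun x => x ∉ I)) (l₂.filter (fun x => x ∉ I))) :
    DihEquiv l₁ l₂ := by
  obtain ⟨a, ha⟩ : S.Nonempty := Finset.card_pos.1 (by omega)
  obtain ⟨u, hu⟩ := List.exists_isRotated_cons (List.mem_toFinset.1 (hS₁ ▸ ha))
  obtain ⟨v, hv⟩ := List.exists_isRotated_cons (List.mem_toFinset.1 (hS₂ ▸ ha))
  have hau : (a :: u).Nodup := hu.nodup_iff.1 h₁
  have hav : (a :: v).Nodup := hv.nodup_iff.1 h₂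
  have hl : l₁.Perm l₂ := List.perm_of_nodup_nodup_toFinset_eq h₁ h₂ (hS₁.trans hS₂.symm)
  have huv : u.Perm v := (hu.perm.symm.trans (hl.trans hv.perm)).cons_inv
  have hmem : ∀ x ∈ a :: u, x ∈ S := fun x hx => by
    rw [← hS₁]; exact List.mem_toFinset.2 (hu.mem_iff.2 hx)
  have huv' : u = v ∨ u.reverse = v := by
    refine hau.of_cons.eq_or_reverse_eq_of_triples huv fun x hx y hy z hz => ?_
    have hcard : m ≤ (S \ {a, x, y, z}).card := by
      have h₃ := Finset.le_card_sdiff {a, x, y, z} S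
      have h₄ : ({a, x, y, z} : Finset α).card ≤ 4 := Finset.card_le_four
      omega
    obtain ⟨I, hI, hIc⟩ := Finset.exists_subset_card_eq hcard
    have hnot : ∀ w ∈ ({a, x, y, z} : Finset α), w ∉ I := fun w hw hwI =>
      (Finset.mem_sdiff.1 (hI hwI)).2 hw
    refine ⟨fun w => w ∉ I, by simpa using hnot x (by simp), by simpa using hnot y (by simp),
      by simpa using hnot z (by simp), ?_⟩
    have h₃ := dihEquiv_trans (dihEquiv_symm (DihEquiv.filter (Or.inl hu) (fun w => w ∉ I)))
      (dihEquiv_trans (H I (hI.trans Finset.sdiff_subset) hIc)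
        (DihEquiv.filter (Or.inl hv) (fun w => w ∉ I)))
    have haI : a ∉ I := hnot a (by simp)
    rw [List.filter_cons_of_pos (by simpa using haI),
      List.filter_cons_of_pos (by simpa using haI)] at h₃
    refine h₃.eq_or_reverse_eq_of_cons ?_
    have h₄ := hau.filter (fun w => w ∉ I)
    rwa [List.filter_cons_of_pos (by simpa using haI)] at h₄
  refine dihEquiv_trans (Or.inl hu) (dihEquiv_trans ?_ (Or.inl hv.symm))
  rcases huv' with rfl | rfl
  · exact dihEquiv_refl _
  · exact dihEquiv_cons_reverse a u

theorem isPreGCO_descendant (k : ℕ) {S : Finset ℕ} {base : List ℕ} (hb : base.Nodup)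
    (hS : base.toFinset = S) : IsPreGCO k S (fun I => base.filter (fun x => x ∉ I)) := by
  intro I _ _
  refine ⟨hb.filter _, ?_⟩
  ext x
  simp [← hS]

theorem isPseudoGCO_of_dihEquiv_descendant (k : ℕ) (S : Finset ℕ) (base : List ℕ)
    (hb : base.Nodup) (hS : base.toFinset = S) (σ : Finset ℕ → List ℕ)
    (hσ : ∀ I : Finset ℕ, I ⊆ S → I.card = k - 2 →
      DihEquiv (σ I) (base.filter (fun x => x ∉ I))) :
    IsPseudoGCO k S σ := by
  induction hm : S.card generalizing S base σ with
  | zero =>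
    rw [IsPseudoGCO, if_pos (by omega)]
    exact ⟨base, hb, hS, hσ⟩
  | succ m ih =>
    rw [IsPseudoGCO]
    split_ifs with hc
    · exact ⟨base, hb, hS, hσ⟩
    · intro i hi
      refine ih (S.erase i) (base.filter (fun x => x ≠ i)) (hb.filter _) ?_ _ ?_ ?_
      · ext x
        simp [← hS, and_comm]
      · intro I hI hIc
        have h := (hσ I (hI.trans (Finset.erase_subset i S)) hIc).filter (fun x => x ≠ i)
        rwa [List.filter_comm] at h
      · rw [Finset.card_erase_of_mem hi, hm, Nat.add_sub_cancel]

/-- Reversal matches the permutations in which `x` precedes `y` with those in which `y`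
precedes `x`. -/
theorem List.Nodup.card_filter_pair_sublist_permutations {α : Type*} [DecidableEq α]
    {L : List α} (hL : L.Nodup) {x y : α} (hx : x ∈ L) (hy : y ∈ L) (hxy : x ≠ y) :
    (L.permutations.toFinset.filter (fun l => [x, y].Sublist l)).card =
      L.length.factorial / 2 := by
  have htot : L.permutations.toFinset.card = L.length.factorial := by
    rw [List.toFinset_card_of_nodup (List.nodup_permutations L hL), List.length_permutations]
  have hsum := Finset.card_filter_add_card_filter_not (s := L.permutations.toFinset)
    (fun l => [x, y].Sublist l)
  have heq : (L.permutations.toFinset.filter (fun l => [x, y].Sublist l)).card =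
      (L.permutations.toFinset.filter (fun l => ¬ [x, y].Sublist l)).card := by
    refine Finset.card_bij' (fun l _ => l.reverse) (fun l _ => l.reverse) ?_ ?_ ?_ ?_
    · intro l hl
      simp only [Finset.mem_filter, List.mem_toFinset, List.mem_permutations] at hl ⊢
      refine ⟨(List.reverse_perm l).trans hl.1, ?_⟩
      rw [List.pair_sublist_reverse_iff]
      exact (hl.1.nodup_iff.2 hL).not_pair_sublist hl.2
    · intro l hl
      simp only [Finset.mem_filter, List.mem_toFinset, List.mem_permutations] at hl ⊢
      refine ⟨(List.reverse_perm l).trans hl.1, ?_⟩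
      rw [List.pair_sublist_reverse_iff]
      exact (List.pair_sublist_or (hl.1.mem_iff.2 hx) (hl.1.mem_iff.2 hy) hxy).resolve_left hl.2
    · simp
    · simp
  omega

/-- Fix `k ≥ 3` and `n ≥ k + 2` and work on the label set `{1, …, n}`.
(a) The descendant of every `(2,n)` color ordering — the pre-GCO whose component at a
`(k-2)`-subset `I` is the restriction of the ordering to `{1,…,n} \ I` — is a `(k,n)`
pseudo-GCO.  (b) Distinct `(2,n)` color orderings have distinct descendants.
(c) Consequently there are exactly `(n-1)!/2` descendant ("type 0") `(k,n)`
pseudo-GCOs. -/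
theorem descendant_pseudoGCOs (k n : ℕ) (hk : 3 ≤ k) (hn : k + 2 ≤ n) :
    -- (a) descendants are pseudo-GCOs
    (∀ base : List ℕ, base.Nodup → base.toFinset = Finset.Icc 1 n →
      IsPreGCO k (Finset.Icc 1 n) (fun I => base.filter (fun x => x ∉ I)) ∧
      IsPseudoGCO k (Finset.Icc 1 n) (fun I => base.filter (fun x => x ∉ I))) ∧
    -- (b) distinct color orderings have distinct descendants
    (∀ base₁ base₂ : List ℕ, base₁.Nodup → base₁.toFinset = Finset.Icc 1 n →
      base₂.Nodup → base₂.toFinset = Finset.Icc 1 n →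
      (∀ I : Finset ℕ, I ⊆ Finset.Icc 1 n → I.card = k - 2 →
        DihEquiv (base₁.filter (fun x => x ∉ I)) (base₂.filter (fun x => x ∉ I))) →
      DihEquiv base₁ base₂) ∧
    -- (c) there are exactly (n-1)!/2 descendant pseudo-GCOs
    Nat.card (Quotient (gcoSetoid k (Finset.Icc 1 n) (fun σ =>
        IsPreGCO k (Finset.Icc 1 n) σ ∧ IsPseudoGCO k (Finset.Icc 1 n) σ ∧
        ∃ base : List ℕ, base.Nodup ∧ base.toFinset = Finset.Icc 1 n ∧
          ∀ I : Finset ℕ, I ⊆ Finset.Icc 1 n → I.card = k - 2 →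
            DihEquiv (σ I) (base.filter (fun x => x ∉ I))))) =
      Nat.factorial (n - 1) / 2 := by
  have hcard : k - 2 + 4 ≤ (Finset.Icc 1 n).card := by
    rw [Nat.card_Icc]
    omega
  refine ⟨fun base hb hS => ⟨isPreGCO_descendant k hb hS,
    isPseudoGCO_of_dihEquiv_descendant k _ base hb hS _ fun I _ _ => dihEquiv_refl _⟩,
    fun base₁ base₂ h₁ hS₁ h₂ hS₂ H => dihEquiv_of_restrictions hcard h₁ hS₁ h₂ hS₂ H, ?_⟩
  have hL : (List.range' 2 (n - 1)).Nodup := List.nodup_range'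
  have hcount := hL.card_filter_pair_sublist_permutations (x := 2) (y := 3)
    (by rw [List.mem_range'_1]; omega) (by rw [List.mem_range'_1]; omega) (by norm_num)
  rw [List.length_range'] at hcount
  rw [← hcount, ← Nat.card_eq_finsetCard]
  have hcons : ∀ l : List ℕ, l.Perm (List.range' 2 (n - 1)) →
      (1 :: l).Nodup ∧ (1 :: l).toFinset = Finset.Icc 1 n := by
    intro l hl
    refine ⟨List.nodup_cons.2 ⟨fun h => ?_, hl.nodup_iff.2 hL⟩, ?_⟩
    · rw [hl.mem_iff, List.mem_range'_1] at h
      omega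
    · ext x
      rw [List.mem_toFinset, List.mem_cons, hl.mem_iff, List.mem_range'_1, Finset.mem_Icc]
      omega
  symm
  refine Nat.card_eq_of_bijective (fun l => Quotient.mk _
    ⟨fun I => (1 :: l.1).filter (fun x => x ∉ I), ?_⟩) ⟨?_, ?_⟩
  · have hl := l.2
    simp only [Finset.mem_filter, List.mem_toFinset, List.mem_permutations] at hl
    obtain ⟨hb, hS⟩ := hcons l.1 hl.1
    exact ⟨isPreGCO_descendant k hb hS, isPseudoGCO_of_dihEquiv_descendant k _ _ hb hS _
      fun I _ _ => dihEquiv_refl _, 1 :: l.1, hb, hS, fun I _ _ => dihEquiv_refl _⟩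
  · rintro ⟨l, hl⟩ ⟨l', hl'⟩ h
    have h := Quotient.exact h
    simp only [Finset.mem_filter, List.mem_toFinset, List.mem_permutations] at hl hl'
    obtain ⟨hb, hS⟩ := hcons l hl.1
    obtain ⟨hb', hS'⟩ := hcons l' hl'.1
    have hd : DihEquiv (1 :: l) (1 :: l') := dihEquiv_of_restrictions hcard hb hS hb' hS' h
    rcases hd.eq_or_reverse_eq_of_cons hb with rfl | rfl
    · rfl
    · exact absurd (List.pair_sublist_reverse_iff.1 hl'.2) (hb.of_cons.not_pair_sublist hl.2)
  · intro q
    induction q using Quotient.inductionOn with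
    | h σ =>
    obtain ⟨σ, hpre, hpseudo, base, hb, hS, hσ⟩ := σ
    have h1 : 1 ∈ base := by
      rw [← List.mem_toFinset, hS, Finset.mem_Icc]
      omega
    obtain ⟨u, hu⟩ := List.exists_isRotated_cons h1
    have hun : (1 :: u).Nodup := hu.nodup_iff.1 hb
    have huL : u.Perm (List.range' 2 (n - 1)) := by
      refine (List.perm_ext_iff_of_nodup hun.of_cons hL).2 fun x => ?_
      have hx : x ∈ 1 :: u ↔ x ∈ Finset.Icc 1 n := by
        rw [← hS, List.mem_toFinset, hu.mem_iff]
      rw [List.mem_cons, Finset.mem_Icc] at hx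
      have h1u : 1 ∉ u := (List.nodup_cons.1 hun).1
      rw [List.mem_range'_1]
      constructor
      · intro h
        have hne : x ≠ 1 := fun h' => h1u (h' ▸ h)
        have := hx.1 (Or.inr h)
        omega
      · intro h
        exact (hx.2 (by omega)).resolve_left (by omega)
    obtain ⟨v, hvL, hv, hdv⟩ : ∃ v : List ℕ, v.Perm (List.range' 2 (n - 1)) ∧
        [2, 3].Sublist v ∧ DihEquiv (1 :: v) base := by
      rcases List.pair_sublist_or (x := 2) (y := 3)
        (huL.mem_iff.2 (by rw [List.mem_range'_1]; omega))
        (huL.mem_iff.2 (by rw [List.mem_range'_1]; omega)) (by norm_num) with h | h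
      · exact ⟨u, huL, h, dihEquiv_symm (Or.inl hu)⟩
      · exact ⟨u.reverse, (List.reverse_perm u).trans huL, List.pair_sublist_reverse_iff.2 h,
          dihEquiv_symm (dihEquiv_trans (Or.inl hu) (dihEquiv_cons_reverse 1 u))⟩
    refine ⟨⟨v, ?_⟩, Quotient.sound fun I hI hIc => ?_⟩
    · simpa only [Finset.mem_filter, List.mem_toFinset, List.mem_permutations] using ⟨hvL, hv⟩
    · exact dihEquiv_trans (hdv.filter (fun x => x ∉ I)) (dihEquiv_symm (hσ I hI hIc))
end

section
/- Let k ≥ 4 and n ≥ k+2. If Σ is a (k,n) pseudo-GCO on {1,…,n}, then for every j ∈ [n] its k-decreasing projection π_{(j)}(Σ) — the (k−1,n−1) pre-GCO on [n]∖{j} whose component at a (k−3)-element subset J ⊆ [n]∖{j} is the component σ^{(J∪{j})} of Σ — is a (k−1,n−1) pseudo-GCO. -/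
/-- The decreasing projection at `j ∈ S` of a pre-GCO on `S` is a pre-GCO on `S \ {j}`. -/
theorem IsPreGCO.decreasing_projection {k : ℕ} (hk : 3 ≤ k) {S : Finset ℕ}
    {σ : Finset ℕ → List ℕ} (h : IsPreGCO k S σ) {j : ℕ} (hj : j ∈ S) :
    IsPreGCO (k - 1) (S.erase j) (fun J => σ (insert j J)) := by
  intro J hJ hcard
  have hjJ : j ∉ J := fun hmem => Finset.notMem_erase j S (hJ hmem)
  obtain ⟨hnodup, hset⟩ := h (insert j J)
    (Finset.insert_subset hj (hJ.trans (Finset.erase_subset j S)))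
    (by rw [Finset.card_insert_of_notMem hjJ]; omega)
  refine ⟨hnodup, hset.trans ?_⟩
  ext x
  simp only [Finset.mem_sdiff, Finset.mem_insert, Finset.mem_erase]
  tauto

/-- The decreasing projection at `j ∈ S` of a pseudo-GCO on `S` is a pseudo-GCO on
`S \ {j}`. -/
theorem IsPseudoGCO.decreasing_projection {k : ℕ} (hk : 3 ≤ k) {S : Finset ℕ}
    (hS : k + 2 ≤ S.card) {σ : Finset ℕ → List ℕ} (h : IsPseudoGCO k S σ) {j : ℕ}
    (hj : j ∈ S) : IsPseudoGCO (k - 1) (S.erase j) (fun J => σ (insert j J)) := by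
  induction hm : S.card generalizing S σ with
  | zero => omega
  | succ m ih =>
    have hcardj := Finset.card_erase_of_mem hj
    rw [IsPseudoGCO] at h ⊢
    split_ifs at h with hle
    · rw [if_pos (by omega)]
      obtain ⟨base, hnodup, hset, hbase⟩ := h
      refine ⟨base.filter (fun x => x ≠ j), hnodup.filter _, ?_, fun J hJ hcard => ?_⟩
      · rw [← hset]
        ext x
        simp [and_comm]
      · have hjJ : j ∉ J := fun hmem => Finset.notMem_erase j S (hJ hmem)
        have key := hbase (insert j J)
          (Finset.insert_subset hj (hJ.trans (Finset.erase_subset j S)))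
          (by rw [Finset.card_insert_of_notMem hjJ]; omega)
        rw [List.filter_filter]
        convert key using 2
        ext x
        simp [Bool.and_comm]
    · rw [if_neg (by omega)]
      intro i hi
      obtain ⟨hij, hiS⟩ := Finset.mem_erase.mp hi
      have hcardi := Finset.card_erase_of_mem hiS
      rw [Finset.erase_right_comm]
      exact ih (by omega) (h i hiS) (Finset.mem_erase.mpr ⟨hij.symm, hj⟩) (by omega)

/-- If `Σ` is a `(k, n)` pseudo-GCO on `{1, …, n}` with `k ≥ 4` and `n ≥ k + 2`, then for
every `j ∈ {1, …, n}` its `k`-decreasing projection `π_{(j)}(Σ)` — the `(k-1, n-1)`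
pre-GCO on `{1, …, n} \ {j}` whose component at a `(k-3)`-element subset `J` is the
component of `Σ` at `J ∪ {j}` — is a `(k-1, n-1)` pseudo-GCO. -/
theorem decreasing_projection_isPseudoGCO (k n : ℕ) (hk : 4 ≤ k) (hn : k + 2 ≤ n)
    (σ : Finset ℕ → List ℕ)
    (hpre : IsPreGCO k (Finset.Icc 1 n) σ)
    (hpseudo : IsPseudoGCO k (Finset.Icc 1 n) σ)
    (j : ℕ) (hj : j ∈ Finset.Icc 1 n) :
    IsPreGCO (k - 1) ((Finset.Icc 1 n).erase j) (fun J => σ (insert j J)) ∧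
    IsPseudoGCO (k - 1) ((Finset.Icc 1 n).erase j) (fun J => σ (insert j J)) := by
  have hcard : k + 2 ≤ (Finset.Icc 1 n).card := by simpa using hn
  exact ⟨hpre.decreasing_projection (by omega) hj,
    hpseudo.decreasing_projection (by omega) hcard hj⟩
end
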